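/- arXiv:hep-th/9610061 — 2 statements merged into one kernel-verified Lean document; each statement's English description precedes it below -/
import Mathlib

section
/- Let x be either the relativistic map x_R(y) = −e^{−y} or the CGHS map x_C(y) = −log(1 + e^{−y}). Let f : ℝ → ℂ be a Schwartz function whose Fourier transform f̂ vanishes for all p ≤ 0. Then the integral ∫_ℝ |F̌(k)|²/(2k) dk converges absolutely and ∫_ℝ |F̌(k)|²/(2k) dk = ∫_0^∞ |f̂(p)|²/(2p) dp; equivalently, ∫_0^∞ (|F̌(k)|² − |F̌(−k)|²)/(2k) dk = ∫_0^∞ |f̂(p)|²/(2p) dp (the Bogoliubov relation A†A = B†B + E). -/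
open MeasureTheory Set Filter
open scoped ENNReal

/-- The Fourier transform `f̂(p) = (2π)^{-1/2} ∫ f(y) e^{-ipy} dy`. -/
noncomputable def ft (f : ℝ → ℂ) (p : ℝ) : ℂ :=
  (Real.sqrt (2 * Real.pi) : ℂ)⁻¹ *
    ∫ y : ℝ, f y * Complex.exp (-Complex.I * (p : ℂ) * (y : ℂ))

/-- `F̌(k) = (2π)^{-1/2} ∫ f(y) e^{-ik x(y)} dy`. -/
noncomputable def Fk (x : ℝ → ℝ) (f : ℝ → ℂ) (k : ℝ) : ℂ :=
  (Real.sqrt (2 * Real.pi) : ℂ)⁻¹ *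
    ∫ y : ℝ, f y * Complex.exp (-Complex.I * (k : ℂ) * (x y : ℂ))

/-- The relativistic black-hole coordinate map `x_R(y) = -e^{-y}`. -/
noncomputable def xR (y : ℝ) : ℝ := -Real.exp (-y)

/-- The CGHS black-hole coordinate map `x_C(y) = -log(1+e^{-y})`. -/
noncomputable def xC (y : ℝ) : ℝ := -Real.log (1 + Real.exp (-y))

/-- The mean number of spontaneously created particles `N̄_o[f]`. -/
noncomputable def No (x : ℝ → ℝ) (f : ℝ → ℂ) : ℝ≥0∞ :=
  ∫⁻ k in Set.Ioi (0:ℝ), ENNReal.ofReal (‖Fk x f (-k)‖ ^ 2 / (2 * k))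

/-- The thermal mean particle number `N̄^Th_β[f]` at inverse temperature `β`. -/
noncomputable def Nth (β : ℝ) (f : ℝ → ℂ) : ℝ≥0∞ :=
  ∫⁻ p in Set.Ioi (0:ℝ),
    ENNReal.ofReal (‖ft f p‖ ^ 2 / (2 * p * (Real.exp (β * p) - 1)))

/-- translate of `f` by `y₀`. -/
noncomputable def tr (f : ℝ → ℂ) (y₀ : ℝ) : ℝ → ℂ := fun y => f (y - y₀)

/-- The truncated oscillatory integral `∫_ε^K e^{-ika} / k dk`. -/
noncomputable def osc (ε K a : ℝ) : ℂ :=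
  ∫ k in ε..K, Complex.exp (-Complex.I * (k : ℂ) * (a : ℂ)) / (k : ℂ)

lemma norm_exp_neg_I_mul_mul (k a : ℝ) :
    ‖Complex.exp (-Complex.I * (k : ℂ) * (a : ℂ))‖ = 1 := by
  have : -Complex.I * (k : ℂ) * (a : ℂ) = ((-(k * a) : ℝ) : ℂ) * Complex.I := by
    push_cast; ring
  rw [this, Complex.norm_exp_ofReal_mul_I]

lemma norm_exp_neg_I_mul_mul_sub_one_le (k a : ℝ) :
    ‖Complex.exp (-Complex.I * (k : ℂ) * (a : ℂ)) - 1‖ ≤ |k| * |a| := by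
  have h : -Complex.I * (k : ℂ) * (a : ℂ) = Complex.I * ((-(k * a) : ℝ) : ℂ) := by
    push_cast; ring
  rw [h, ← abs_mul]
  simpa using Real.norm_exp_I_mul_ofReal_sub_one_le (x := -(k * a))

lemma pos_of_mem_uIcc {ε K k : ℝ} (hε : 0 < ε) (hK : 0 < K) (hk : k ∈ uIcc ε K) : 0 < k :=
  lt_of_lt_of_le (lt_min hε hK) hk.1

lemma continuousOn_osc_integrand {ε K : ℝ} (hε : 0 < ε) (hK : 0 < K) (a : ℝ) :
    ContinuousOn (fun k : ℝ => Complex.exp (-Complex.I * (k : ℂ) * (a : ℂ)) / (k : ℂ))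
      (uIcc ε K) := by
  refine ContinuousOn.div (by fun_prop) (by fun_prop) fun k hk => ?_
  exact_mod_cast (pos_of_mem_uIcc hε hK hk).ne'

lemma osc_add_osc {ε m K : ℝ} (hε : 0 < ε) (hm : 0 < m) (hK : 0 < K) (a : ℝ) :
    osc ε m a + osc m K a = osc ε K a :=
  intervalIntegral.integral_add_adjacent_intervals
    (continuousOn_osc_integrand hε hm a).intervalIntegrable
    (continuousOn_osc_integrand hm hK a).intervalIntegrable

/-- Tail bound, from one integration by parts. -/
lemma norm_osc_le {m K a : ℝ} (hm : 0 < m) (hmK : m ≤ K) (ha : a ≠ 0) :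
    ‖osc m K a‖ ≤ 2 / (m * |a|) := by
  have hK : 0 < K := hm.trans_le hmK
  have ha' : (a : ℂ) ≠ 0 := by exact_mod_cast ha
  have habs : 0 < |a| := abs_pos.mpr ha
  set c : ℂ := Complex.I * a with hc
  have hc0 : c ≠ 0 := mul_ne_zero Complex.I_ne_zero ha'
  have hcn : ‖c‖ = |a| := by simp [hc]
  set e : ℝ → ℂ := fun k => Complex.exp (-Complex.I * (k : ℂ) * (a : ℂ)) with he
  have hen : ∀ k, ‖e k‖ = 1 := fun k => norm_exp_neg_I_mul_mul k a
  have hecont : Continuous e := by fun_prop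
  have hder : ∀ k ∈ uIcc m K, HasDerivAt (fun k : ℝ => -(e k / (c * k)))
      (e k / k + e k / (c * (k : ℂ) ^ 2)) k := by
    intro k hk
    have hk0 : (k : ℂ) ≠ 0 := by exact_mod_cast (pos_of_mem_uIcc hm hK hk).ne'
    have h1 : HasDerivAt (fun k : ℝ => (k : ℂ)) 1 k := Complex.ofRealCLM.hasDerivAt
    have h2 : HasDerivAt e (e k * (-Complex.I * 1 * a)) k :=
      ((h1.const_mul (-Complex.I)).mul_const (a : ℂ)).cexp
    have h3 : HasDerivAt (fun k : ℝ => -(e k / (c * k))) _ k :=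
      (h2.div (h1.const_mul c) (mul_ne_zero hc0 hk0)).neg
    refine h3.congr_deriv ?_
    field_simp
    rw [hc]
    ring
  have hi1 : IntervalIntegrable (fun k : ℝ => e k / k) volume m K :=
    (continuousOn_osc_integrand hm hK a).intervalIntegrable
  have hi2 : IntervalIntegrable (fun k : ℝ => e k / (c * (k : ℂ) ^ 2)) volume m K := by
    refine ContinuousOn.intervalIntegrable
      (hecont.continuousOn.div (by fun_prop) fun k hk => ?_)
    have hk0 : (k : ℂ) ≠ 0 := by exact_mod_cast (pos_of_mem_uIcc hm hK hk).ne'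
    exact mul_ne_zero hc0 (pow_ne_zero _ hk0)
  have hftc := intervalIntegral.integral_eq_sub_of_hasDerivAt hder (hi1.add hi2)
  rw [intervalIntegral.integral_add hi1 hi2] at hftc
  have hosc : osc m K a = -(e K / (c * K)) - -(e m / (c * m)) -
      ∫ k in m..K, e k / (c * (k : ℂ) ^ 2) := by
    rw [← hftc, osc]; ring
  have hinv : ∫ k in m..K, 1 / |a| * (k ^ 2)⁻¹ = 1 / |a| * (1 / m - 1 / K) := by
    rw [intervalIntegral.integral_const_mul]
    congr 1
    have : ∀ k ∈ uIcc m K, HasDerivAt (fun k : ℝ => -k⁻¹) ((k ^ 2)⁻¹) k := by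
      intro k hk
      have h : HasDerivAt (fun k : ℝ => -k⁻¹) _ k :=
        (hasDerivAt_inv (pos_of_mem_uIcc hm hK hk).ne').neg
      exact h.congr_deriv (neg_neg _)
    rw [intervalIntegral.integral_eq_sub_of_hasDerivAt this]
    · simp; ring
    · refine ContinuousOn.intervalIntegrable (ContinuousOn.inv₀ (by fun_prop) fun k hk => ?_)
      exact pow_ne_zero _ (pos_of_mem_uIcc hm hK hk).ne'
  have hrem : ‖∫ k in m..K, e k / (c * (k : ℂ) ^ 2)‖ ≤ 1 / |a| * (1 / m - 1 / K) := by
    rw [← hinv]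
    refine intervalIntegral.norm_integral_le_of_norm_le hmK (ae_of_all _ fun k _ => ?_) ?_
    · rw [norm_div, hen, norm_mul, hcn, norm_pow, Complex.norm_real, Real.norm_eq_abs, sq_abs]
      rw [one_div, one_div, mul_inv]
    · refine ContinuousOn.intervalIntegrable
        (continuousOn_const.mul (ContinuousOn.inv₀ (by fun_prop) fun k hk => ?_))
      exact pow_ne_zero _ (pos_of_mem_uIcc hm hK hk).ne'
  have hn : ∀ k : ℝ, 0 < k → ‖-(e k / (c * k))‖ = 1 / |a| * (1 / k) := by
    intro k hk
    rw [norm_neg, norm_div, hen, norm_mul, hcn, Complex.norm_real, Real.norm_of_nonneg hk.le]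
    rw [one_div, one_div, one_div, mul_inv]
  calc ‖osc m K a‖ ≤ 1 / |a| * (1 / K) + 1 / |a| * (1 / m) + 1 / |a| * (1 / m - 1 / K) := by
        rw [hosc, ← hn K hK, ← hn m hm]
        exact (norm_sub_le _ _).trans (add_le_add (norm_sub_le _ _) hrem)
    _ = 2 / (m * |a|) := by field_simp; ring

lemma norm_osc_sub_log_le {ε m a : ℝ} (hε : 0 < ε) (hm : ε ≤ m) :
    ‖osc ε m a - Real.log (m / ε)‖ ≤ (m - ε) * |a| := by
  have hm0 : 0 < m := hε.trans_le hm
  have hlog : ((Real.log (m / ε) : ℝ) : ℂ) = ∫ k in ε..m, (1 : ℂ) / (k : ℂ) := by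
    rw [← integral_one_div_of_pos hε hm0, ← intervalIntegral.integral_ofReal]
    simp
  have hi : IntervalIntegrable (fun k : ℝ => (1 : ℂ) / (k : ℂ)) volume ε m := by
    refine ContinuousOn.intervalIntegrable (ContinuousOn.div (by fun_prop) (by fun_prop) ?_)
    intro k hk
    exact_mod_cast (pos_of_mem_uIcc hε hm0 hk).ne'
  rw [hlog, osc, ← intervalIntegral.integral_sub
    (continuousOn_osc_integrand hε hm0 a).intervalIntegrable hi]
  have := intervalIntegral.norm_integral_le_of_norm_le_const (a := ε) (b := m) (C := |a|)
    (f := fun k : ℝ => Complex.exp (-Complex.I * (k : ℂ) * (a : ℂ)) / (k : ℂ) - 1 / (k : ℂ)) ?_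
  · rwa [abs_of_nonneg (sub_nonneg.mpr hm), mul_comm] at this
  · intro k hk
    have hk0 : 0 < k := pos_of_mem_uIcc hε hm0 (uIoc_subset_uIcc hk)
    rw [← sub_div, norm_div, Complex.norm_real, div_le_iff₀ (norm_pos_iff.mpr hk0.ne'),
      Real.norm_eq_abs, mul_comm |a|]
    exact norm_exp_neg_I_mul_mul_sub_one_le k a

lemma norm_osc_add_log_le {ε K a : ℝ} (hε : 0 < ε) (hε1 : ε ≤ 1) (hK1 : 1 ≤ K) (ha : a ≠ 0) :
    ‖osc ε K a + Real.log ε‖ ≤ 3 + |Real.log a| := by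
  have hK : 0 < K := one_pos.trans_le hK1
  have habs : 0 < |a| := abs_pos.mpr ha
  have hb : 0 < |a|⁻¹ := inv_pos.mpr habs
  have hlogb : |Real.log |a|⁻¹| = |Real.log a| := by
    rw [Real.log_inv, Real.log_abs, abs_neg]
  -- split at `m`, the projection of `|a|⁻¹` to `[ε, K]`
  obtain ⟨m, hεm, hmK, h1, h2, h3⟩ : ∃ m, ε ≤ m ∧ m ≤ K ∧ |Real.log m| ≤ |Real.log a| ∧
      (m - ε) * |a| ≤ 1 ∧ ‖osc m K a‖ ≤ 2 := by
    rcases le_total |a|⁻¹ ε with h | h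
    · refine ⟨ε, le_rfl, hε1.trans hK1, ?_, by simp, ?_⟩
      · rw [← hlogb, abs_of_nonpos (Real.log_nonpos hε.le hε1),
          abs_of_nonpos (Real.log_nonpos hb.le (h.trans hε1))]
        exact neg_le_neg (Real.log_le_log hb h)
      · refine (norm_osc_le hε (hε1.trans hK1) ha).trans ?_
        rw [div_le_iff₀ (by positivity)]
        have := (inv_le_iff_one_le_mul₀ habs).mp h
        linarith
    rcases le_total |a|⁻¹ K with h' | h'
    · refine ⟨|a|⁻¹, h, h', hlogb.le, ?_, ?_⟩
      · rw [sub_mul, inv_mul_cancel₀ habs.ne']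
        nlinarith [mul_pos hε habs]
      · refine (norm_osc_le hb h' ha).trans ?_
        rw [inv_mul_cancel₀ habs.ne']; norm_num
    · refine ⟨K, hε1.trans hK1, le_rfl, ?_, ?_, by simp [osc]⟩
      · rw [← hlogb, abs_of_nonneg (Real.log_nonneg hK1),
          abs_of_nonneg (Real.log_nonneg (hK1.trans h'))]
        exact Real.log_le_log hK h'
      · have := mul_le_mul_of_nonneg_right h' habs.le
        rw [inv_mul_cancel₀ habs.ne'] at this
        nlinarith [mul_pos hε habs]
  have hm : 0 < m := hε.trans_le hεm
  have hsplit : osc ε K a + Real.log ε =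
      (osc ε m a - Real.log (m / ε)) + osc m K a + Real.log m := by
    rw [← osc_add_osc hε hm hK, Real.log_div hm.ne' hε.ne']
    push_cast; ring
  rw [hsplit]
  calc _ ≤ ‖osc ε m a - Real.log (m / ε)‖ + ‖osc m K a‖ + ‖((Real.log m : ℝ) : ℂ)‖ :=
        norm_add₃_le
    _ ≤ 1 + 2 + |Real.log a| := by
        gcongr
        · exact (norm_osc_sub_log_le hε hεm).trans h2
        · simpa using h1
    _ = _ := by ring

lemma exp_sub_exp_div_eq_sinc {k : ℝ} (hk : k ≠ 0) (a : ℝ) :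
    Complex.exp (-Complex.I * (k : ℂ) * (a : ℂ)) / (k : ℂ) -
      Complex.exp (-Complex.I * (k : ℂ) * ((-a : ℝ) : ℂ)) / (k : ℂ) =
      -2 * Complex.I * ((Real.sinc (k * a) * a : ℝ) : ℂ) := by
  rcases eq_or_ne a 0 with rfl | ha
  · simp
  have hk' : (k : ℂ) ≠ 0 := by exact_mod_cast hk
  have ha' : (a : ℂ) ≠ 0 := by exact_mod_cast ha
  have e1 : -Complex.I * (k : ℂ) * (a : ℂ) = -((k * a : ℂ) * Complex.I) := by ring
  have e2 : -Complex.I * (k : ℂ) * ((-a : ℝ) : ℂ) = (k * a : ℂ) * Complex.I := by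
    push_cast; ring
  rw [Real.sinc_of_ne_zero (mul_ne_zero hk ha), e1, e2]
  push_cast
  rw [Complex.sin]
  field_simp
  linear_combination (Complex.exp (-(k * a * Complex.I)) - Complex.exp (k * a * Complex.I)) *
    Complex.I_sq

lemma osc_sub_osc_neg {ε K : ℝ} (hε : 0 < ε) (hK : 0 < K) (a : ℝ) :
    osc ε K a - osc ε K (-a) =
      -2 * Complex.I * ((∫ u in (ε * a)..(K * a), Real.sinc u : ℝ) : ℂ) := by
  rw [osc, osc, ← intervalIntegral.integral_sub
    (continuousOn_osc_integrand hε hK a).intervalIntegrable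
    (continuousOn_osc_integrand hε hK (-a)).intervalIntegrable]
  rw [← intervalIntegral.mul_integral_comp_mul_right, ← intervalIntegral.integral_const_mul,
    ← intervalIntegral.integral_ofReal, ← intervalIntegral.integral_const_mul]
  refine intervalIntegral.integral_congr fun k hk => ?_
  rw [exp_sub_exp_div_eq_sinc (pos_of_mem_uIcc hε hK hk).ne', mul_comm a]

lemma abs_integral_sinc_le {s t : ℝ} (hs : 0 < s) (hst : s ≤ t) :
    |∫ u in s..t, Real.sinc u| ≤ 2 / s := by
  have h := osc_sub_osc_neg hs (hs.trans_le hst) 1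
  have h1 := norm_osc_le hs hst one_ne_zero
  have h2 := norm_osc_le hs hst (neg_ne_zero.mpr one_ne_zero)
  have h3 := congrArg norm h
  rw [mul_one, mul_one, norm_mul, Complex.norm_real, Real.norm_eq_abs] at h3
  have h4 : ‖-2 * Complex.I‖ = 2 := by simp
  rw [h4] at h3
  simp only [abs_neg, abs_one, mul_one] at h1 h2
  have := norm_sub_le (osc s t 1) (osc s t (-1))
  linarith

lemma tendsto_osc_sub_osc {a b : ℝ} (hab : 0 < a * b) :
    Tendsto (fun n : ℕ => (osc ((n : ℝ) + 1)⁻¹ (n + 1) a - osc ((n : ℝ) + 1)⁻¹ (n + 1) (-a)) -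
      (osc ((n : ℝ) + 1)⁻¹ (n + 1) b - osc ((n : ℝ) + 1)⁻¹ (n + 1) (-b))) atTop (nhds 0) := by
  wlog ha : 0 < a generalizing a b
  · have ha' : 0 < -a := by
      rcases lt_trichotomy a 0 with h | h | h
      · linarith
      · simp [h] at hab
      · exact absurd h ha
    have := (this (a := -a) (b := -b) (by linarith) ha').neg
    rw [neg_zero] at this
    refine this.congr fun n => ?_
    rw [neg_neg, neg_neg]; ring
  have hb : 0 < b := (pos_iff_pos_of_mul_pos hab).mp ha
  wlog hba : b ≤ a generalizing a b
  · have := (this (a := b) (b := a) (by linarith) hb ha (le_of_not_ge hba)).neg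
    rw [neg_zero] at this
    exact this.congr fun n => by ring
  have hsi : ∀ s t : ℝ, IntervalIntegrable Real.sinc volume s t :=
    fun s t => Real.continuous_sinc.intervalIntegrable s t
  have hlim : Tendsto (fun n : ℕ => (4 / b + 2 * (a - b)) * ((n : ℝ) + 1)⁻¹) atTop (nhds 0) := by
    have := (tendsto_one_div_add_atTop_nhds_zero_nat (𝕜 := ℝ)).const_mul (4 / b + 2 * (a - b))
    simpa using this
  refine squeeze_zero_norm (fun n => ?_) hlim
  set T : ℝ := (n : ℝ) + 1 with hT
  have hT0 : 0 < T := by positivity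
  have hTi : 0 < T⁻¹ := inv_pos.mpr hT0
  rw [osc_sub_osc_neg hTi hT0, osc_sub_osc_neg hTi hT0, ← mul_sub, ← Complex.ofReal_sub,
    intervalIntegral.integral_interval_sub_interval_comm (hsi _ _) (hsi _ _) (hsi _ _),
    norm_mul, Complex.norm_real, Real.norm_eq_abs]
  have h4 : ‖-2 * Complex.I‖ = 2 := by simp
  rw [h4]
  have h1 : |∫ u in (T⁻¹ * a)..(T⁻¹ * b), Real.sinc u| ≤ T⁻¹ * (a - b) := by
    have := intervalIntegral.norm_integral_le_of_norm_le_const (a := T⁻¹ * a) (b := T⁻¹ * b)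
      (C := 1) (f := Real.sinc) fun u _ => Real.abs_sinc_le_one u
    rw [one_mul, ← mul_sub, abs_mul, abs_of_pos hTi, abs_sub_comm,
      abs_of_nonneg (sub_nonneg.mpr hba)] at this
    exact this
  have h2 : |∫ u in (T * a)..(T * b), Real.sinc u| ≤ 2 / (T * b) := by
    rw [intervalIntegral.integral_symm, abs_neg]
    exact abs_integral_sinc_le (by positivity) (by gcongr)
  have h3 : 2 / (T * b) = 2 / b * T⁻¹ := by field_simp
  calc _ ≤ 2 * (T⁻¹ * (a - b) + 2 / b * T⁻¹) := by
        gcongr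
        exact (abs_sub _ _).trans (add_le_add h1 (h2.trans h3.le))
    _ = _ := by ring

lemma Fk_neg (x : ℝ → ℝ) (f : ℝ → ℂ) (k : ℝ) : Fk x f (-k) = Fk (fun y => -x y) f k := by
  simp [Fk]

lemma Fk_id (f : ℝ → ℂ) (k : ℝ) : Fk (fun y => y) f k = ft f k := rfl

lemma continuous_Fk {x : ℝ → ℝ} (hx : Continuous x) {f : ℝ → ℂ} (hf : Integrable f) :
    Continuous (Fk x f) := by
  refine continuous_const.mul (continuous_of_dominated (bound := fun y => ‖f y‖) ?_ ?_ hf.norm ?_)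
  · intro k
    exact hf.aestronglyMeasurable.mul (by fun_prop : Continuous fun y : ℝ =>
      Complex.exp (-Complex.I * (k : ℂ) * (x y : ℂ))).aestronglyMeasurable
  · intro k
    refine ae_of_all _ fun y => ?_
    rw [norm_mul, norm_exp_neg_I_mul_mul, mul_one]
  · exact ae_of_all _ fun y => by fun_prop

lemma normSq_Fk (x : ℝ → ℝ) (f : ℝ → ℂ) (k : ℝ) :
    ((‖Fk x f k‖ ^ 2 : ℝ) : ℂ) = (2 * Real.pi : ℂ)⁻¹ * ∫ z : ℝ × ℝ,
      f z.1 * (starRingEnd ℂ) (f z.2) *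
        Complex.exp (-Complex.I * (k : ℂ) * ((x z.1 - x z.2 : ℝ) : ℂ)) := by
  have hprod : ∀ z : ℝ × ℝ, f z.1 * (starRingEnd ℂ) (f z.2) *
        Complex.exp (-Complex.I * (k : ℂ) * ((x z.1 - x z.2 : ℝ) : ℂ)) =
      (f z.1 * Complex.exp (-Complex.I * (k : ℂ) * (x z.1 : ℂ))) *
        (starRingEnd ℂ) (f z.2 * Complex.exp (-Complex.I * (k : ℂ) * (x z.2 : ℂ))) := by
    intro z
    rw [map_mul, ← Complex.exp_conj, mul_mul_mul_comm, ← Complex.exp_add]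
    congr 2
    simp only [map_mul, map_neg, Complex.conj_I, Complex.conj_ofReal]
    push_cast; ring
  simp_rw [hprod]
  rw [Measure.volume_eq_prod, integral_prod_mul
    (fun y => f y * Complex.exp (-Complex.I * (k : ℂ) * (x y : ℂ)))
    (fun y => (starRingEnd ℂ) (f y * Complex.exp (-Complex.I * (k : ℂ) * (x y : ℂ)))),
    integral_conj, Complex.mul_conj, Fk, norm_mul, mul_pow, Complex.normSq_eq_norm_sq]
  have hs : ‖((Real.sqrt (2 * Real.pi) : ℂ))⁻¹‖ ^ 2 = (2 * Real.pi)⁻¹ := by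
    rw [norm_inv, Complex.norm_real, Real.norm_of_nonneg (Real.sqrt_nonneg _), inv_pow,
      Real.sq_sqrt (by positivity)]
  rw [hs]
  push_cast
  rfl

lemma integrable_mul_conj {f : ℝ → ℂ} (hf : Integrable f) :
    Integrable (fun z : ℝ × ℝ => f z.1 * (starRingEnd ℂ) (f z.2)) :=
  hf.mul_prod ((LinearIsometryEquiv.integrable_comp_iff Complex.conjLIE).mpr hf)

lemma integral_normSq_Fk_div {x : ℝ → ℝ} (hx : Continuous x) {f : ℝ → ℂ} (hf : Integrable f)
    {ε K : ℝ} (hε : 0 < ε) (hK : 0 < K) :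
    ((∫ k in ε..K, ‖Fk x f k‖ ^ 2 / k : ℝ) : ℂ) = (2 * Real.pi : ℂ)⁻¹ * ∫ z : ℝ × ℝ,
      f z.1 * (starRingEnd ℂ) (f z.2) * osc ε K (x z.1 - x z.2) := by
  have hinv : Integrable (fun k : ℝ => (k : ℂ)⁻¹) (volume.restrict (uIoc ε K)) := by
    refine (ContinuousOn.intervalIntegrable (ContinuousOn.inv₀ (by fun_prop) ?_)).def'
    intro k hk
    exact_mod_cast (pos_of_mem_uIcc hε hK hk).ne'
  have hint : Integrable (Function.uncurry fun (k : ℝ) (z : ℝ × ℝ) =>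
      f z.1 * (starRingEnd ℂ) (f z.2) *
        (Complex.exp (-Complex.I * (k : ℂ) * ((x z.1 - x z.2 : ℝ) : ℂ)) / (k : ℂ)))
      ((volume.restrict (uIoc ε K)).prod volume) := by
    have h := (hinv.mul_prod (integrable_mul_conj hf)).bdd_mul (c := 1)
      (f := fun p : ℝ × ℝ × ℝ =>
        Complex.exp (-Complex.I * (p.1 : ℂ) * ((x p.2.1 - x p.2.2 : ℝ) : ℂ)))
      (by fun_prop : Continuous _).aestronglyMeasurable
      (ae_of_all _ fun p => (norm_exp_neg_I_mul_mul _ _).le)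
    refine h.congr (ae_of_all _ fun p => ?_)
    simp only [Function.uncurry, div_eq_mul_inv]
    ring
  have hswap := intervalIntegral_integral_swap hint
  rw [← intervalIntegral.integral_ofReal]
  simp_rw [intervalIntegral.integral_const_mul] at hswap
  unfold osc
  rw [← hswap, ← intervalIntegral.integral_const_mul]
  refine intervalIntegral.integral_congr fun k _ => ?_
  rw [Complex.ofReal_div, normSq_Fk, mul_div_assoc, ← integral_div]
  simp_rw [mul_div_assoc]

lemma measurable_osc (ε K : ℝ) : Measurable (osc ε K) := by
  have hm : StronglyMeasurable (Function.uncurry fun a k : ℝ =>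
      Complex.exp (-Complex.I * (k : ℂ) * (a : ℂ)) / (k : ℂ)) := by
    refine Measurable.stronglyMeasurable ?_
    unfold Function.uncurry
    fun_prop
  unfold osc intervalIntegral
  exact (hm.integral_prod_right (ν := volume.restrict (Ioc ε K))).measurable.sub
    (hm.integral_prod_right (ν := volume.restrict (Ioc K ε))).measurable

/-- Logarithmic comparison between the increments of a coordinate map and those of `id`. -/
def LogComparable (x : ℝ → ℝ) : Prop :=
  ∀ y y', y ≠ y' → x y ≠ x y' ∧
    |Real.log (x y - x y')| ≤ 1 + |y| + |y'| + |Real.log (y - y')|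

lemma LogComparable.neg {x : ℝ → ℝ} (hx : LogComparable x) : LogComparable fun y => -x y := by
  intro y y' h
  refine ⟨fun h' => (hx y y' h).1 (neg_injective h'), ?_⟩
  rw [← neg_sub', Real.log_neg_eq_log]
  exact (hx y y' h).2

lemma logComparable_id : LogComparable fun y => y :=
  fun y y' h => ⟨h, by have := abs_nonneg y; have := abs_nonneg y'; linarith⟩

lemma logComparable_of_hasDerivAt {x x' : ℝ → ℝ} (hx : ∀ y, HasDerivAt x (x' y) y)
    (hpos : ∀ y, 0 < x' y) (hlog : ∀ y, |Real.log (x' y)| ≤ 1 + |y|) : LogComparable x := by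
  intro y y' h
  wlog hlt : y' < y generalizing y y'
  · obtain ⟨h1, h2⟩ := this y' y h.symm (lt_of_le_of_ne (not_lt.mp hlt) h)
    refine ⟨h1.symm, ?_⟩
    rw [← neg_sub (x y'), Real.log_neg_eq_log, ← neg_sub y', Real.log_neg_eq_log]
    linarith
  obtain ⟨ξ, hξ, hslope⟩ := exists_hasDerivAt_eq_slope x x' hlt
    (fun z _ => (hx z).continuousAt.continuousWithinAt) fun z _ => hx z
  have hd : 0 < y - y' := sub_pos.mpr hlt
  have heq : x y - x y' = x' ξ * (y - y') := by
    rw [hslope, div_mul_cancel₀ _ hd.ne']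
  refine ⟨sub_ne_zero.mp (heq ▸ (mul_pos (hpos ξ) hd).ne'), ?_⟩
  rw [heq, Real.log_mul (hpos ξ).ne' hd.ne']
  have h1 : |ξ| ≤ |y| + |y'| := by
    refine abs_le.mpr ⟨?_, ?_⟩
    · linarith [hξ.1, neg_abs_le y', abs_nonneg y]
    · linarith [hξ.2, le_abs_self y, abs_nonneg y']
  linarith [abs_add_le (Real.log (x' ξ)) (Real.log (y - y')), hlog ξ]

lemma hasDerivAt_exp_neg (y : ℝ) : HasDerivAt (fun y => Real.exp (-y)) (-Real.exp (-y)) y := by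
  simpa using (hasDerivAt_neg y).exp

lemma hasDerivAt_xR (y : ℝ) : HasDerivAt xR (Real.exp (-y)) y :=
  (hasDerivAt_exp_neg y).neg.congr_deriv (neg_neg _)

lemma hasDerivAt_xC (y : ℝ) : HasDerivAt xC (Real.exp (-y) / (1 + Real.exp (-y))) y :=
  (((hasDerivAt_exp_neg y).const_add 1).log (by positivity)).neg.congr_deriv (by
    rw [neg_div, neg_neg])

lemma logComparable_xR : LogComparable xR :=
  logComparable_of_hasDerivAt hasDerivAt_xR (fun y => Real.exp_pos _) fun y => by
    rw [Real.log_exp, abs_neg]; linarith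

lemma logComparable_xC : LogComparable xC := by
  refine logComparable_of_hasDerivAt hasDerivAt_xC (fun y => by positivity) fun y => ?_
  have hle : Real.exp (-y) / (1 + Real.exp (-y)) ≤ 1 :=
    (div_le_one (by positivity)).mpr (by linarith)
  rw [abs_of_nonpos (Real.log_nonpos (by positivity) hle), neg_le,
    Real.le_log_iff_exp_le (by positivity), le_div_iff₀ (by positivity)]
  have h2 : (2 : ℝ) ≤ Real.exp 1 := by linarith [Real.add_one_le_exp (1 : ℝ)]
  have h3 : Real.exp (-|y|) ≤ 1 := Real.exp_le_one_iff.mpr (by simp)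
  have h4 : Real.exp (-|y|) ≤ Real.exp (-y) := Real.exp_le_exp.mpr (neg_le_neg (le_abs_self y))
  have h5 : Real.exp (-|y|) * Real.exp (-y) ≤ Real.exp (-y) :=
    mul_le_of_le_one_left (Real.exp_pos _).le h3
  have h6 : Real.exp (-(1 + |y|)) * Real.exp 1 = Real.exp (-|y|) := by
    rw [← Real.exp_add]; congr 1; ring
  have h7 : 2 * Real.exp (-(1 + |y|)) ≤ Real.exp (-|y|) := by
    nlinarith [Real.exp_pos (-(1 + |y|))]
  nlinarith [Real.exp_pos (-(1 + |y|)), Real.exp_pos (-y)]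

lemma ae_fst_ne_snd : ∀ᵐ z : ℝ × ℝ, z.1 ≠ z.2 := by
  have hs : MeasurableSet {z : ℝ × ℝ | z.1 = z.2} :=
    measurableSet_eq_fun measurable_fst measurable_snd
  have h : (volume : Measure (ℝ × ℝ)) {z : ℝ × ℝ | z.1 = z.2} = 0 := by
    rw [Measure.volume_eq_prod, Measure.measure_prod_null hs]
    refine ae_of_all _ fun y => ?_
    have : Prod.mk y ⁻¹' {z : ℝ × ℝ | z.1 = z.2} = {y} := by
      ext z; simp [eq_comm]
    simp [this]
  rw [ae_iff]
  simpa using h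

/-- The logarithm majorant of the products `f y * conj (f y')` is integrable. -/
lemma integrable_logMajorant (f : SchwartzMap ℝ ℂ) {c : ℝ} (hc : 0 ≤ c) :
    Integrable fun z : ℝ × ℝ =>
      ‖f z.1‖ * ‖f z.2‖ * (c + |z.1| + |z.2| + |Real.log (z.1 - z.2)|) := by
  have h0 : Integrable fun y => ‖f y‖ := f.integrable.norm
  have h1 : Integrable fun y : ℝ => |y| * ‖f y‖ := by
    simpa using f.integrable_pow_mul volume 1
  set L : ℝ → ℝ := (Icc (-1) 1).indicator fun t => |Real.log t| with hL
  have hLi : Integrable L := by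
    rw [hL, integrable_indicator_iff measurableSet_Icc, integrableOn_Icc_iff_integrableOn_Ioc,
      ← intervalIntegrable_iff_integrableOn_Ioc_of_le (by norm_num)]
    exact intervalIntegral.intervalIntegrable_log'.abs
  have hL0 : ∀ t, 0 ≤ L t := fun t => indicator_nonneg (fun _ _ => abs_nonneg _) t
  have hlog : ∀ t : ℝ, |Real.log t| ≤ L t + |t| := by
    intro t
    by_cases ht : t ∈ Icc (-1 : ℝ) 1
    · rw [hL, indicator_of_mem ht]; linarith [abs_nonneg t]
    · rw [hL, indicator_of_notMem ht, zero_add, ← Real.log_abs t]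
      have ht1 : 1 < |t| := by
        by_contra h
        exact ht (abs_le.mp (not_lt.mp h))
      rw [abs_of_nonneg (Real.log_nonneg ht1.le)]
      linarith [Real.log_le_sub_one_of_pos (one_pos.trans ht1)]
  obtain ⟨C, -, hC⟩ := f.decay 0 0
  have hC' : ∀ y, ‖f y‖ ≤ C := fun y => by simpa using hC y
  have hconv : Integrable fun z : ℝ × ℝ => ‖f z.2‖ * L (z.1 - z.2) :=
    h0.convolution_integrand (ContinuousLinearMap.mul ℝ ℝ) hLi
  have hmaj : Integrable fun z : ℝ × ℝ => c * (‖f z.1‖ * ‖f z.2‖) +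
      2 * ((|z.1| * ‖f z.1‖) * ‖f z.2‖) + 2 * (‖f z.1‖ * (|z.2| * ‖f z.2‖)) +
      C * (‖f z.2‖ * L (z.1 - z.2)) :=
    ((((h0.mul_prod h0).const_mul c).add ((h1.mul_prod h0).const_mul 2)).add
      ((h0.mul_prod h1).const_mul 2)).add (hconv.const_mul C)
  have hm : Measurable fun z : ℝ × ℝ =>
      ‖f z.1‖ * ‖f z.2‖ * (c + |z.1| + |z.2| + |Real.log (z.1 - z.2)|) := by
    have := f.continuous.measurable
    fun_prop
  refine hmaj.mono' hm.aestronglyMeasurable (ae_of_all _ fun z => ?_)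
  rw [Real.norm_of_nonneg (by positivity)]
  have hw : 0 ≤ ‖f z.1‖ * ‖f z.2‖ := by positivity
  have hsub : |z.1 - z.2| ≤ |z.1| + |z.2| := abs_sub _ _
  have hle : |Real.log (z.1 - z.2)| ≤ L (z.1 - z.2) + (|z.1| + |z.2|) :=
    (hlog _).trans (by gcongr)
  have e1 := mul_le_mul_of_nonneg_left hle hw
  have e2 := mul_le_mul_of_nonneg_right (hC' z.1)
    (mul_nonneg (norm_nonneg (f z.2)) (hL0 (z.1 - z.2)))
  linarith

lemma norm_mul_osc_le {x : ℝ → ℝ} (hlog : LogComparable x) (f : ℝ → ℂ) {ε K : ℝ} (hε : 0 < ε)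
    (hε1 : ε ≤ 1) (hK : 1 ≤ K) {z : ℝ × ℝ} (hz : z.1 ≠ z.2) :
    ‖f z.1 * (starRingEnd ℂ) (f z.2) * (osc ε K (x z.1 - x z.2) + Real.log ε)‖ ≤
      ‖f z.1‖ * ‖f z.2‖ * (4 + |z.1| + |z.2| + |Real.log (z.1 - z.2)|) := by
  obtain ⟨h1, h2⟩ := hlog _ _ hz
  rw [norm_mul, norm_mul, RCLike.norm_conj]
  gcongr
  linarith [norm_osc_add_log_le hε hε1 hK (sub_ne_zero.mpr h1)]

lemma integrable_mul_osc_add_log {x : ℝ → ℝ} (hx : Continuous x) (hlog : LogComparable x)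
    (f : SchwartzMap ℝ ℂ) {ε K : ℝ} (hε : 0 < ε) (hε1 : ε ≤ 1) (hK : 1 ≤ K) :
    Integrable fun z : ℝ × ℝ =>
      f z.1 * (starRingEnd ℂ) (f z.2) * (osc ε K (x z.1 - x z.2) + Real.log ε) := by
  refine (integrable_logMajorant f zero_le_four).mono' ?_
    (ae_fst_ne_snd.mono fun z hz => norm_mul_osc_le hlog f hε hε1 hK hz)
  refine (integrable_mul_conj f.integrable).aestronglyMeasurable.mul ?_
  have hx' : Measurable fun z : ℝ × ℝ => x z.1 - x z.2 := by
    have := hx.measurable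
    fun_prop
  exact (((measurable_osc ε K).comp hx').add_const _).aestronglyMeasurable

lemma integrable_mul_osc {x : ℝ → ℝ} (hx : Continuous x) (hlog : LogComparable x)
    (f : SchwartzMap ℝ ℂ) {ε K : ℝ} (hε : 0 < ε) (hε1 : ε ≤ 1) (hK : 1 ≤ K) :
    Integrable fun z : ℝ × ℝ =>
      f z.1 * (starRingEnd ℂ) (f z.2) * osc ε K (x z.1 - x z.2) := by
  refine ((integrable_mul_osc_add_log hx hlog f hε hε1 hK).sub
    ((integrable_mul_conj f.integrable).mul_const ((Real.log ε : ℝ) : ℂ))).congr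
    (ae_of_all _ fun z => ?_)
  simp only [Pi.sub_apply]
  ring

lemma integral_mul_osc_add_log {x : ℝ → ℝ} (hx : Continuous x) (hlog : LogComparable x)
    (f : SchwartzMap ℝ ℂ) (hf : ∫ y, f y = 0) {ε K : ℝ} (hε : 0 < ε) (hε1 : ε ≤ 1)
    (hK : 1 ≤ K) :
    ∫ z : ℝ × ℝ, f z.1 * (starRingEnd ℂ) (f z.2) * (osc ε K (x z.1 - x z.2) + Real.log ε) =
      ∫ z : ℝ × ℝ, f z.1 * (starRingEnd ℂ) (f z.2) * osc ε K (x z.1 - x z.2) := by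
  simp_rw [mul_add]
  rw [integral_add (integrable_mul_osc hx hlog f hε hε1 hK)
    ((integrable_mul_conj f.integrable).mul_const _), integral_mul_const,
    Measure.volume_eq_prod, integral_prod_mul (fun y => f y) (fun y => (starRingEnd ℂ) (f y)), hf]
  simp

lemma integral_normSq_Fk_div_le {x : ℝ → ℝ} (hx : Continuous x) (hlog : LogComparable x)
    (f : SchwartzMap ℝ ℂ) (hf : ∫ y, f y = 0) {ε K : ℝ} (hε : 0 < ε) (hε1 : ε ≤ 1)
    (hK : 1 ≤ K) :
    ∫ k in ε..K, ‖Fk x f k‖ ^ 2 / k ≤ (2 * Real.pi)⁻¹ * ∫ z : ℝ × ℝ,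
      ‖f z.1‖ * ‖f z.2‖ * (4 + |z.1| + |z.2| + |Real.log (z.1 - z.2)|) := by
  have h := congrArg norm (integral_normSq_Fk_div hx f.integrable hε (one_pos.trans_le hK))
  rw [← integral_mul_osc_add_log hx hlog f hf hε hε1 hK, Complex.norm_real, norm_mul] at h
  refine (Real.le_norm_self _).trans (h.le.trans ?_)
  have hpi : ‖(2 * Real.pi : ℂ)⁻¹‖ = (2 * Real.pi)⁻¹ := by
    rw [norm_inv, norm_mul, Complex.norm_real, Real.norm_of_nonneg Real.pi_pos.le]
    simp
  rw [hpi]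
  gcongr
  exact norm_integral_le_of_norm_le (integrable_logMajorant f zero_le_four)
    (ae_fst_ne_snd.mono fun z hz => norm_mul_osc_le hlog f hε hε1 hK hz)

lemma one_le_natCast_add_one (n : ℕ) : (1 : ℝ) ≤ (n : ℝ) + 1 :=
  le_add_of_nonneg_left n.cast_nonneg

lemma aecover_Ioc_inv_nat :
    AECover (volume.restrict (Ioi (0 : ℝ))) atTop
      fun n : ℕ => Ioc ((n : ℝ) + 1)⁻¹ ((n : ℝ) + 1) where
  ae_eventually_mem := by
    refine (ae_restrict_iff' measurableSet_Ioi).mpr (ae_of_all _ fun k hk => ?_)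
    have hk0 : (0 : ℝ) < k := hk
    have h := tendsto_natCast_atTop_atTop (R := ℝ)
    filter_upwards [h.eventually_ge_atTop k, h.eventually_ge_atTop k⁻¹] with n h1 h2
    refine ⟨?_, by linarith⟩
    rw [inv_lt_comm₀ (by positivity) hk0]
    linarith
  measurableSet _ := measurableSet_Ioc

lemma setIntegral_Ioc_inv_nat (g : ℝ → ℝ) (n : ℕ) :
    ∫ k in Ioc ((n : ℝ) + 1)⁻¹ ((n : ℝ) + 1), g k ∂(volume.restrict (Ioi 0)) =
      ∫ k in ((n : ℝ) + 1)⁻¹..((n : ℝ) + 1), g k := by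
  have h1 := one_le_natCast_add_one n
  rw [intervalIntegral.integral_of_le ((inv_le_one_of_one_le₀ h1).trans h1),
    Measure.restrict_restrict_of_subset]
  exact fun k hk => (inv_pos.mpr (by positivity)).trans hk.1

lemma integrableOn_normSq_Fk_div {x : ℝ → ℝ} (hx : Continuous x) (hlog : LogComparable x)
    (f : SchwartzMap ℝ ℂ) (hf : ∫ y, f y = 0) :
    IntegrableOn (fun k => ‖Fk x f k‖ ^ 2 / k) (Ioi 0) := by
  refine aecover_Ioc_inv_nat.integrable_of_integral_bounded_of_nonneg_ae
    ((2 * Real.pi)⁻¹ * ∫ z : ℝ × ℝ,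
      ‖f z.1‖ * ‖f z.2‖ * (4 + |z.1| + |z.2| + |Real.log (z.1 - z.2)|))
    (fun n => ?_) ?_ (Eventually.of_forall fun n => ?_)
  · have h0 : (0 : ℝ) < ((n : ℝ) + 1)⁻¹ := by positivity
    refine IntegrableOn.mono_measure ?_ Measure.restrict_le_self
    refine IntegrableOn.mono_set (ContinuousOn.integrableOn_Icc ?_) Ioc_subset_Icc_self
    refine ContinuousOn.div ?_ continuousOn_id fun k hk => (h0.trans_le hk.1).ne'
    exact ((continuous_Fk hx f.integrable).norm.pow 2).continuousOn
  · refine (ae_restrict_iff' measurableSet_Ioi).mpr (ae_of_all _ fun k hk => ?_)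
    have hk0 : (0 : ℝ) < k := hk
    exact div_nonneg (sq_nonneg _) hk0.le
  · have h1 := one_le_natCast_add_one n
    rw [setIntegral_Ioc_inv_nat]
    exact integral_normSq_Fk_div_le hx hlog f hf (by positivity) (inv_le_one_of_one_le₀ h1) h1

lemma tendsto_integral_normSq_Fk_div {x : ℝ → ℝ} (hx : Continuous x) (hlog : LogComparable x)
    (f : SchwartzMap ℝ ℂ) (hf : ∫ y, f y = 0) :
    Tendsto (fun n : ℕ => ∫ k in ((n : ℝ) + 1)⁻¹..((n : ℝ) + 1), ‖Fk x f k‖ ^ 2 / k) atTop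
      (nhds (∫ k in Ioi (0 : ℝ), ‖Fk x f k‖ ^ 2 / k)) := by
  simp_rw [← setIntegral_Ioc_inv_nat]
  exact aecover_Ioc_inv_nat.integral_tendsto_of_countably_generated
    (integrableOn_normSq_Fk_div hx hlog f hf)

/-- The kernel of the double-integral form of the truncated momentum integral. -/
noncomputable def oscKernel (f : ℝ → ℂ) (x : ℝ → ℝ) (n : ℕ) (z : ℝ × ℝ) : ℂ :=
  f z.1 * (starRingEnd ℂ) (f z.2) * osc ((n : ℝ) + 1)⁻¹ (n + 1) (x z.1 - x z.2)

lemma integrable_oscKernel {x : ℝ → ℝ} (hx : Continuous x) (hlog : LogComparable x)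
    (f : SchwartzMap ℝ ℂ) (n : ℕ) : Integrable (oscKernel f x n) :=
  integrable_mul_osc hx hlog f (by positivity)
    (inv_le_one_of_one_le₀ (one_le_natCast_add_one n)) (one_le_natCast_add_one n)

lemma norm_oscKernel_add_log_le {x : ℝ → ℝ} (hlog : LogComparable x) (f : ℝ → ℂ) (n : ℕ)
    {z : ℝ × ℝ} (hz : z.1 ≠ z.2) :
    ‖oscKernel f x n z + f z.1 * (starRingEnd ℂ) (f z.2) * Real.log ((n : ℝ) + 1)⁻¹‖ ≤
      ‖f z.1‖ * ‖f z.2‖ * (4 + |z.1| + |z.2| + |Real.log (z.1 - z.2)|) := by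
  rw [oscKernel, ← mul_add]
  exact norm_mul_osc_le hlog f (by positivity)
    (inv_le_one_of_one_le₀ (one_le_natCast_add_one n)) (one_le_natCast_add_one n) hz

lemma tendsto_oscKernel_sub {x : ℝ → ℝ} (hmono : StrictMono x) (f : ℝ → ℂ) {z : ℝ × ℝ}
    (hz : z.1 ≠ z.2) :
    Tendsto (fun n : ℕ => (oscKernel f x n z - oscKernel f (fun y => -x y) n z) -
      (oscKernel f (fun y => y) n z - oscKernel f (fun y => -y) n z)) atTop (nhds 0) := by
  have hpos : 0 < (x z.1 - x z.2) * (z.1 - z.2) := by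
    rcases lt_or_gt_of_ne hz with h | h
    · exact mul_pos_of_neg_of_neg (sub_neg.mpr (hmono h)) (sub_neg.mpr h)
    · exact mul_pos (sub_pos.mpr (hmono h)) (sub_pos.mpr h)
  have h := (tendsto_osc_sub_osc hpos).const_mul (f z.1 * (starRingEnd ℂ) (f z.2))
  rw [mul_zero] at h
  refine h.congr fun n => ?_
  simp only [oscKernel, neg_sub_neg, neg_sub]
  ring

lemma norm_sub_sub_sub_le {E : Type*} [SeminormedAddCommGroup E] {a b c d l : E} {B : ℝ}
    (ha : ‖a + l‖ ≤ B) (hb : ‖b + l‖ ≤ B) (hc : ‖c + l‖ ≤ B) (hd : ‖d + l‖ ≤ B) :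
    ‖(a - b) - (c - d)‖ ≤ 4 * B := by
  rw [← add_sub_add_right_eq_sub a b l, ← add_sub_add_right_eq_sub c d l]
  linarith [norm_sub_le (a + l - (b + l)) (c + l - (d + l)), norm_sub_le (a + l) (b + l),
    norm_sub_le (c + l) (d + l)]

lemma tendsto_integral_oscKernel_sub {x : ℝ → ℝ} (hx : Continuous x) (hmono : StrictMono x)
    (hlog : LogComparable x) (f : SchwartzMap ℝ ℂ) :
    Tendsto (fun n : ℕ =>
      ((∫ z, oscKernel f x n z) - ∫ z, oscKernel f (fun y => -x y) n z) -
      ((∫ z, oscKernel f (fun y => y) n z) - ∫ z, oscKernel f (fun y => -y) n z))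
      atTop (nhds 0) := by
  have i1 := integrable_oscKernel hx hlog f
  have i2 := integrable_oscKernel (x := fun y => -x y) hx.neg hlog.neg f
  have i3 := integrable_oscKernel (x := fun y => y) continuous_id logComparable_id f
  have i4 := integrable_oscKernel (x := fun y => -y) continuous_neg logComparable_id.neg f
  have h := tendsto_integral_of_dominated_convergence
      (F := fun n z => (oscKernel f x n z - oscKernel f (fun y => -x y) n z) -
        (oscKernel f (fun y => y) n z - oscKernel f (fun y => -y) n z)) (f := fun _ => 0)
      (fun z : ℝ × ℝ =>
        4 * (‖f z.1‖ * ‖f z.2‖ * (4 + |z.1| + |z.2| + |Real.log (z.1 - z.2)|)))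
      (fun n => (((i1 n).sub (i2 n)).sub ((i3 n).sub (i4 n))).aestronglyMeasurable)
      ((integrable_logMajorant f zero_le_four).const_mul 4)
      (fun n => ae_fst_ne_snd.mono fun z hz => norm_sub_sub_sub_le
        (norm_oscKernel_add_log_le hlog f n hz) (norm_oscKernel_add_log_le hlog.neg f n hz)
        (norm_oscKernel_add_log_le logComparable_id f n hz)
        (norm_oscKernel_add_log_le logComparable_id.neg f n hz))
      (ae_fst_ne_snd.mono fun z hz => tendsto_oscKernel_sub hmono f hz)
  rw [integral_zero] at h
  refine h.congr fun n => ?_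
  rw [← integral_sub (i1 n) (i2 n), ← integral_sub (i3 n) (i4 n)]
  exact integral_sub ((i1 n).sub (i2 n)) ((i3 n).sub (i4 n))

lemma integral_normSq_Fk_div_eq_oscKernel {x : ℝ → ℝ} (hx : Continuous x) {f : ℝ → ℂ}
    (hf : Integrable f) (n : ℕ) :
    ((∫ k in ((n : ℝ) + 1)⁻¹..((n : ℝ) + 1), ‖Fk x f k‖ ^ 2 / k : ℝ) : ℂ) =
      (2 * Real.pi : ℂ)⁻¹ * ∫ z, oscKernel f x n z :=
  integral_normSq_Fk_div hx hf (by positivity) (by positivity)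

/-- The signed momentum integral does not depend on the increasing coordinate map. -/
lemma integral_normSq_Fk_sub_eq {x : ℝ → ℝ} (hx : Continuous x) (hmono : StrictMono x)
    (hlog : LogComparable x) (f : SchwartzMap ℝ ℂ) (hf : ∫ y, f y = 0) :
    (∫ k in Ioi (0 : ℝ), ‖Fk x f k‖ ^ 2 / k) -
        ∫ k in Ioi (0 : ℝ), ‖Fk (fun y => -x y) f k‖ ^ 2 / k =
      (∫ k in Ioi (0 : ℝ), ‖Fk (fun y => y) f k‖ ^ 2 / k) -
        ∫ k in Ioi (0 : ℝ), ‖Fk (fun y => -y) f k‖ ^ 2 / k := by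
  have hxn : Continuous fun y => -x y := hx.neg
  have hid : Continuous fun y : ℝ => y := continuous_id
  have hidn : Continuous fun y : ℝ => -y := continuous_neg
  have hlim := ((tendsto_integral_normSq_Fk_div hx hlog f hf).sub
    (tendsto_integral_normSq_Fk_div hxn hlog.neg f hf)).sub
    ((tendsto_integral_normSq_Fk_div hid logComparable_id f hf).sub
    (tendsto_integral_normSq_Fk_div hidn logComparable_id.neg f hf))
  rw [← sub_eq_zero]
  refine tendsto_nhds_unique hlim ?_
  rw [← tendsto_ofReal_iff]
  have h := (tendsto_integral_oscKernel_sub hx hmono hlog f).const_mul (2 * Real.pi : ℂ)⁻¹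
  rw [mul_zero] at h
  refine h.congr fun n => ?_
  simp only [Complex.ofReal_sub, mul_sub,
    integral_normSq_Fk_div_eq_oscKernel hx f.integrable n,
    integral_normSq_Fk_div_eq_oscKernel hxn f.integrable n,
    integral_normSq_Fk_div_eq_oscKernel hid f.integrable n,
    integral_normSq_Fk_div_eq_oscKernel hidn f.integrable n]

/-- For `x = x_R` or `x = x_C` and a Schwartz function `f` whose Fourier
transform vanishes for `p ≤ 0`, the integral `∫ |F̌(k)|²/(2k) dk` converges absolutely and
equals `∫_0^∞ |f̂(p)|²/(2p) dp`; equivalently the Bogoliubov relation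
`∫_0^∞ (|F̌(k)|² - |F̌(-k)|²)/(2k) dk = ∫_0^∞ |f̂(p)|²/(2p) dp` holds. -/
theorem stmt_0 (x : ℝ → ℝ) (hx : x = xR ∨ x = xC) (f : SchwartzMap ℝ ℂ)
    (hfp : ∀ p : ℝ, p ≤ 0 → ft (⇑f) p = 0) :
    MeasureTheory.Integrable (fun k : ℝ => ‖Fk x (⇑f) k‖ ^ 2 / (2 * k)) ∧
    (∫ k : ℝ, ‖Fk x (⇑f) k‖ ^ 2 / (2 * k)) =
      (∫ p in Set.Ioi (0:ℝ), ‖ft (⇑f) p‖ ^ 2 / (2 * p)) ∧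
    (∫ k in Set.Ioi (0:ℝ),
        (‖Fk x (⇑f) k‖ ^ 2 - ‖Fk x (⇑f) (-k)‖ ^ 2) / (2 * k)) =
      (∫ p in Set.Ioi (0:ℝ), ‖ft (⇑f) p‖ ^ 2 / (2 * p)) := by
  have hf : ∫ y, f y = 0 := by
    have h := hfp 0 le_rfl
    have hpi : ((Real.sqrt (2 * Real.pi) : ℝ) : ℂ)⁻¹ ≠ 0 :=
      inv_ne_zero (by exact_mod_cast (Real.sqrt_pos.mpr (by positivity)).ne')
    simpa using (mul_eq_zero.mp h).resolve_left hpi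
  obtain ⟨hcont, hmono, hlog⟩ : Continuous x ∧ StrictMono x ∧ LogComparable x := by
    rcases hx with rfl | rfl
    · exact ⟨continuous_iff_continuousAt.mpr fun y => (hasDerivAt_xR y).continuousAt,
        strictMono_of_hasDerivAt_pos hasDerivAt_xR fun y => Real.exp_pos _, logComparable_xR⟩
    · exact ⟨continuous_iff_continuousAt.mpr fun y => (hasDerivAt_xC y).continuousAt,
        strictMono_of_hasDerivAt_pos hasDerivAt_xC fun y => by positivity, logComparable_xC⟩
  have hpos := integrableOn_normSq_Fk_div hcont hlog f hf
  have hcontn : Continuous fun y => -x y := hcont.neg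
  have hneg := integrableOn_normSq_Fk_div hcontn hlog.neg f hf
  have hmain := integral_normSq_Fk_sub_eq hcont hmono hlog f hf
  have hzero : ∫ k in Ioi (0 : ℝ), ‖Fk (fun y => -y) f k‖ ^ 2 / k = 0 := by
    refine setIntegral_eq_zero_of_forall_eq_zero fun k hk => ?_
    rw [← Fk_neg (fun y => y), Fk_id, hfp _ (neg_nonpos.mpr (le_of_lt hk))]
    simp
  simp_rw [hzero, sub_zero, Fk_id] at hmain
  have hhalf : ∀ a k : ℝ, a / (2 * k) = 2⁻¹ * (a / k) := fun a k => by
    rw [div_mul_eq_div_div, div_right_comm]; ring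
  simp_rw [hhalf]
  have hdiff : (∫ k in Ioi (0 : ℝ), 2⁻¹ * ((‖Fk x f k‖ ^ 2 - ‖Fk x f (-k)‖ ^ 2) / k)) =
      ∫ p in Ioi (0 : ℝ), 2⁻¹ * (‖ft f p‖ ^ 2 / p) := by
    simp_rw [integral_const_mul, ← hmain, Fk_neg, sub_div]
    rw [integral_sub hpos hneg]
  have hnegI : IntegrableOn (fun k => ‖Fk x f k‖ ^ 2 / k) (Iic 0) := by
    rw [integrableOn_Iic_iff_integrableOn_Iio, ← (Measure.measurePreserving_neg
      volume).integrableOn_comp_preimage (Homeomorph.neg ℝ).measurableEmbedding]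
    simpa [Function.comp_def, Fk_neg, div_neg] using hneg.neg
  have hint : Integrable fun k => ‖Fk x f k‖ ^ 2 / k := by
    rw [← integrableOn_univ, ← Iic_union_Ioi (a := (0 : ℝ))]
    exact hnegI.union hpos
  refine ⟨hint.const_mul _, ?_, hdiff⟩
  rw [← hdiff, integral_const_mul, integral_const_mul]
  congr 1
  rw [← intervalIntegral.integral_Iic_add_Ioi hnegI hpos]
  have hflip : ∫ k in Iic (0 : ℝ), ‖Fk x f k‖ ^ 2 / k =
      -∫ k in Ioi (0 : ℝ), ‖Fk x f (-k)‖ ^ 2 / k := by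
    rw [← integral_neg, ← neg_zero, ← integral_comp_neg_Ioi]
    simp [div_neg]
  simp_rw [hflip, Fk_neg, sub_div]
  rw [integral_sub hpos hneg]
  ring
end

section
/- Let x = x_R be the relativistic map x_R(y) = −e^{−y}, and let f : ℝ → ℂ be integrable with f̂(p) = 0 for a.e. p ≤ 0. Then, as an equality in [0, ∞], N̄_o[f] = ∫_0^∞ |f̂(p)|²/(2p(e^{2πp} − 1)) dp; that is, the spontaneously emitted radiation of the relativistic black hole is exactly thermal at inverse temperature 2π. -/
open MeasureTheory Set Filter
open scoped ENNReal

open Topology FourierTransform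
open scoped ContDiff

/-- Plancherel's theorem for functions that are both integrable and square integrable. -/
theorem lintegral_enorm_fourier_sq {h : ℝ → ℂ} (h1 : Integrable h) (h2 : MemLp h 2) :
    ∫⁻ ξ, ‖𝓕 h ξ‖ₑ ^ 2 = ∫⁻ x, ‖h x‖ₑ ^ 2 := by
  set H : Lp ℂ 2 (volume : Measure ℝ) := h2.toLp h with hH
  have hcont : Continuous (𝓕 h) :=
    VectorFourier.fourierIntegral_continuous Real.continuous_fourierChar
      (innerSL ℝ).continuous₂ h1
  have key : ∀ᵐ ξ, (𝓕 H : Lp ℂ 2 (volume : Measure ℝ)) ξ = 𝓕 h ξ := by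
    refine ae_eq_of_integral_contDiff_smul_eq
      ((Lp.memLp _).locallyIntegrable (by norm_num)) hcont.locallyIntegrable ?_
    intro g hg hgs
    have hg₁ : HasCompactSupport (Complex.ofRealCLM ∘ g) := hgs.comp_left rfl
    have hg₂ : ContDiff ℝ ∞ (Complex.ofRealCLM ∘ g) := by fun_prop
    let φ : SchwartzMap ℝ ℂ := hg₁.toSchwartzMap hg₂
    have hφ : ∀ x, φ x = (g x : ℂ) := fun x => rfl
    have e1 := congrArg (fun T : TemperedDistribution ℝ ℂ => T φ)
      (MeasureTheory.Lp.fourier_toTemperedDistribution_eq H)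
    simp only [TemperedDistribution.fourier_apply, Lp.toTemperedDistribution_apply, hφ] at e1
    have e2 : ∫ x, (𝓕 φ) x • H x = ∫ x, (𝓕 (φ : ℝ → ℂ)) x • h x := by
      refine integral_congr_ae ?_
      filter_upwards [h2.coeFn_toLp] with x hx
      rw [hx, SchwartzMap.fourier_coe]
    have e3 := VectorFourier.integral_fourierIntegral_smul_eq_flip (μ := volume) (ν := volume)
      (L := innerₗ ℝ) Real.continuous_fourierChar (innerSL ℝ).continuous₂ φ.integrable h1
    have e4 : ∫ x, (𝓕 (φ : ℝ → ℂ)) x • h x = ∫ x, φ x • (𝓕 h) x := by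
      have hflip : (innerₗ ℝ).flip = innerₗ ℝ := by ext; simp
      rw [hflip] at e3
      exact e3
    rw [e2, e4] at e1
    simp only [hφ] at e1
    simpa using e1.symm
  have n1 : ‖(𝓕 H : Lp ℂ 2 (volume : Measure ℝ))‖ₑ = ‖H‖ₑ := by
    rw [← ofReal_norm, ← ofReal_norm, MeasureTheory.Lp.norm_fourier_eq]
  rw [Lp.enorm_def, Lp.enorm_def, eLpNorm_congr_ae key, eLpNorm_congr_ae h2.coeFn_toLp] at n1
  have n2 : ∀ u : ℝ → ℂ, eLpNorm u 2 volume ^ (2:ℝ) = ∫⁻ x, ‖u x‖ₑ ^ 2 := by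
    intro u
    rw [eLpNorm_eq_lintegral_rpow_enorm_toReal (by norm_num) (by norm_num), ← ENNReal.rpow_mul]
    simp
  rw [← n2, ← n2, n1]

theorem ft_eq_fourier (f : ℝ → ℂ) (p : ℝ) :
    ft f p = (Real.sqrt (2 * Real.pi) : ℂ)⁻¹ * 𝓕 f (p / (2 * Real.pi)) := by
  rw [ft, Real.fourier_eq']
  congr 1
  refine integral_congr_ae (Eventually.of_forall fun y => ?_)
  have : (Real.pi : ℂ) ≠ 0 := by exact_mod_cast Real.pi_ne_zero
  simp only [smul_eq_mul, mul_comm (f y)]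
  congr 2
  simp
  field_simp

theorem continuous_ft {f : ℝ → ℂ} (hf : Integrable f) : Continuous (ft f) := by
  have hcont : Continuous (𝓕 f) :=
    VectorFourier.fourierIntegral_continuous Real.continuous_fourierChar
      (innerSL ℝ).continuous₂ hf
  rw [funext (ft_eq_fourier f)]
  fun_prop

theorem norm_ft_le (f : ℝ → ℂ) (p : ℝ) :
    ‖ft f p‖ ≤ (Real.sqrt (2 * Real.pi))⁻¹ * ∫ y, ‖f y‖ := by
  rw [ft, norm_mul, norm_inv, Complex.norm_real, Real.norm_of_nonneg (Real.sqrt_nonneg _)]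
  gcongr
  refine (norm_integral_le_integral_norm _).trans_eq ?_
  refine integral_congr_ae (Eventually.of_forall fun y => ?_)
  simp [Complex.norm_exp]

theorem enorm_sqrt_two_pi_sq :
    ‖(Real.sqrt (2 * Real.pi) : ℂ)‖ₑ ^ 2 = ENNReal.ofReal (2 * Real.pi) := by
  rw [← ofReal_norm, Complex.norm_real, Real.norm_of_nonneg (Real.sqrt_nonneg _),
    ← ENNReal.ofReal_pow (Real.sqrt_nonneg _), Real.sq_sqrt (by positivity)]

theorem lintegral_comp_div_two_pi (u : ℝ → ℝ≥0∞) :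
    ∫⁻ p, u (p / (2 * Real.pi)) = ENNReal.ofReal (2 * Real.pi) * ∫⁻ ξ, u ξ := by
  have h0 : (2 * Real.pi)⁻¹ ≠ 0 := by positivity
  have hm := Real.map_volume_mul_right h0
  have he : MeasurableEmbedding (fun p : ℝ => p * (2 * Real.pi)⁻¹) :=
    (Homeomorph.mulRight₀ _ h0).measurableEmbedding
  simp_rw [div_eq_mul_inv]
  rw [← he.lintegral_map, hm, lintegral_smul_measure, inv_inv, abs_of_pos (by positivity),
    smul_eq_mul]

theorem lintegral_enorm_ft_sq {h : ℝ → ℂ} (h1 : Integrable h) (h2 : MemLp h 2) :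
    ∫⁻ p, ‖ft h p‖ₑ ^ 2 = ∫⁻ x, ‖h x‖ₑ ^ 2 := by
  rw [← lintegral_enorm_fourier_sq h1 h2]
  have hp : ENNReal.ofReal (2 * Real.pi) ≠ 0 := by simp [Real.pi_pos]
  have e : ∀ p, ‖ft h p‖ₑ ^ 2 =
      (ENNReal.ofReal (2 * Real.pi))⁻¹ * ‖𝓕 h (p / (2 * Real.pi))‖ₑ ^ 2 := by
    intro p
    rw [ft_eq_fourier, enorm_mul, mul_pow, enorm_inv, ← ENNReal.inv_pow, enorm_sqrt_two_pi_sq]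
    · simpa using (Real.sqrt_pos.2 Real.pi_pos).ne'
  simp_rw [e]
  rw [lintegral_const_mul' _ _ (by simpa using hp),
    lintegral_comp_div_two_pi (fun ξ => ‖𝓕 h ξ‖ₑ ^ 2), ← mul_assoc,
    ENNReal.inv_mul_cancel hp ENNReal.ofReal_ne_top, one_mul]

theorem memLp_two_of_norm_le {h : ℝ → ℂ} (h1 : Integrable h) {C : ℝ} (hC : ∀ x, ‖h x‖ ≤ C) :
    MemLp h 2 := by
  rw [memLp_two_iff_integrable_sq_norm h1.aestronglyMeasurable]
  simp_rw [sq]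
  exact h1.norm.bdd_mul (c := C) h1.norm.aestronglyMeasurable
    (Eventually.of_forall fun x => by simpa using hC x)

theorem norm_integral_mul_comp_sub_le {f K : ℝ → ℂ} (hf : Integrable f) {C : ℝ}
    (hC : ∀ x, ‖K x‖ ≤ C) (s : ℝ) : ‖∫ y, f y * K (s - y)‖ ≤ (∫ y, ‖f y‖) * C := by
  rw [← integral_mul_const]
  refine norm_integral_le_of_norm_le (hf.norm.mul_const C) (Eventually.of_forall fun y => ?_)
  rw [norm_mul]
  gcongr
  exact hC _

theorem integrable_integral_mul_comp_sub {f K : ℝ → ℂ} (hf : Integrable f) (hK : Integrable K) :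
    Integrable fun s => ∫ y, f y * K (s - y) :=
  hf.integrable_convolution (ContinuousLinearMap.mul ℂ ℂ) hK

theorem ft_integral_mul_comp_sub {f K : ℝ → ℂ} (hf : Integrable f) (hK : Integrable K) (p : ℝ) :
    ft (fun s => ∫ y, f y * K (s - y)) p = Real.sqrt (2 * Real.pi) * (ft f p * ft K p) := by
  have h := Real.fourier_mul_convolution_eq hf hK (p / (2 * Real.pi))
  have h' : 𝓕 (fun s => ∫ y, f y * K (s - y)) (p / (2 * Real.pi)) =
    𝓕 f (p / (2 * Real.pi)) * 𝓕 K (p / (2 * Real.pi)) := h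
  have h0 : (Real.sqrt (2 * Real.pi) : ℂ) ≠ 0 := by
    exact_mod_cast (Real.sqrt_pos.2 (by positivity)).ne'
  rw [ft_eq_fourier, ft_eq_fourier, ft_eq_fourier, h']
  field_simp

/-- Plancherel's theorem for a convolution with a bounded integrable kernel. -/
theorem lintegral_enorm_integral_mul_comp_sub_sq {f K : ℝ → ℂ} (hf : Integrable f)
    (hK : Integrable K) {C : ℝ} (hC : ∀ x, ‖K x‖ ≤ C) :
    ∫⁻ s, ‖∫ y, f y * K (s - y)‖ₑ ^ 2 =
      ENNReal.ofReal (2 * Real.pi) * ∫⁻ p, ‖ft f p * ft K p‖ₑ ^ 2 := by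
  have hi := integrable_integral_mul_comp_sub hf hK
  rw [← lintegral_enorm_ft_sq hi
    (memLp_two_of_norm_le hi (norm_integral_mul_comp_sub_le hf hC)),
    ← lintegral_const_mul' _ _ ENNReal.ofReal_ne_top]
  simp_rw [ft_integral_mul_comp_sub hf hK]
  refine lintegral_congr fun p => ?_
  rw [enorm_mul (Real.sqrt (2 * Real.pi) : ℂ), mul_pow, enorm_sqrt_two_pi_sq]


theorem integrableOn_cpow_mul_exp_neg_mul {z a : ℂ} (hz : 0 < z.re) (ha : 0 < a.re) :
    IntegrableOn (fun t : ℝ => (t : ℂ) ^ (z - 1) * Complex.exp (-(a * t))) (Ioi 0) := by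
  have h := integrableOn_rpow_mul_exp_neg_mul_rpow (p := 1) (s := z.re - 1) (by linarith) one_pos ha
  refine Integrable.mono' h ?_ ?_
  · refine ContinuousOn.aestronglyMeasurable (fun t ht => ?_) measurableSet_Ioi
    refine ContinuousAt.continuousWithinAt ?_
    have : ContinuousAt (fun t : ℝ => (t : ℂ) ^ (z - 1)) t :=
      (Complex.continuousAt_ofReal_cpow_const _ _ (Or.inr (ne_of_gt ht)))
    exact this.mul (by fun_prop)
  · refine (ae_restrict_iff' measurableSet_Ioi).2 (Eventually.of_forall fun t ht => ?_)
    rw [norm_mul, Complex.norm_cpow_eq_rpow_re_of_pos ht, Complex.norm_exp]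
    simp

theorem differentiableAt_integral_cpow_mul_exp_neg_mul {z a : ℂ} (hz : 0 < z.re) (ha : 0 < a.re) :
    DifferentiableAt ℂ (fun a : ℂ => ∫ t : ℝ in Ioi 0,
      (t : ℂ) ^ (z - 1) * Complex.exp (-(a * t))) a := by
  have hb : IntegrableOn (fun t : ℝ => t ^ z.re * Real.exp (-(a.re / 2) * t ^ (1 : ℝ))) (Ioi 0) :=
    integrableOn_rpow_mul_exp_neg_mul_rpow (by linarith) one_pos (by linarith)
  have hint := integrableOn_cpow_mul_exp_neg_mul (z := z + 1) (by simp; linarith) ha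
  refine (hasDerivAt_integral_of_dominated_loc_of_deriv_le
    (μ := volume.restrict (Ioi 0))
    (F := fun (a : ℂ) (t : ℝ) => (t : ℂ) ^ (z - 1) * Complex.exp (-(a * t)))
    (F' := fun (a : ℂ) (t : ℝ) => -((t : ℂ) ^ (z + 1 - 1) * Complex.exp (-(a * t))))
    (s := Metric.ball a (a.re / 2)) (Metric.ball_mem_nhds _ (by linarith)) ?_
    (integrableOn_cpow_mul_exp_neg_mul hz ha) hint.neg.aestronglyMeasurable
    ?_ hb ?_).2.differentiableAt
  · filter_upwards [(isOpen_lt continuous_const Complex.continuous_re).mem_nhds ha] with b hb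
    exact (integrableOn_cpow_mul_exp_neg_mul hz hb).aestronglyMeasurable
  · refine (ae_restrict_iff' measurableSet_Ioi).2 (Eventually.of_forall fun t ht b hb => ?_)
    have h1 : |(b - a).re| < a.re / 2 :=
      (Complex.abs_re_le_norm _).trans_lt (by simpa [dist_eq_norm] using hb)
    rw [Complex.sub_re, abs_lt] at h1
    have ht0 : (0 : ℝ) < t := ht
    rw [norm_neg, norm_mul, Complex.norm_cpow_eq_rpow_re_of_pos ht, Complex.norm_exp]
    simp only [add_sub_cancel_right, Real.rpow_one]
    gcongr
    simp
    nlinarith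
  · refine (ae_restrict_iff' measurableSet_Ioi).2 (Eventually.of_forall fun t ht b hb => ?_)
    have ht0 : (t : ℂ) ≠ 0 := by exact_mod_cast (ne_of_gt ht)
    have h1 : HasDerivAt (fun b : ℂ => -(b * t)) (-(1 * t)) b :=
      ((hasDerivAt_id b).mul_const (t : ℂ)).neg
    have h2 := (h1.cexp.const_mul ((t : ℂ) ^ (z - 1)))
    refine h2.congr_deriv ?_
    rw [add_sub_right_comm, Complex.cpow_add _ _ ht0, Complex.cpow_one]
    ring

/-- Euler's integral `∫ t ^ (z - 1) * exp (-a t) = a ^ (-z) * Γ z` for complex `a` with positive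
real part. -/
theorem integral_cpow_mul_exp_neg_mul {z a : ℂ} (hz : 0 < z.re) (ha : 0 < a.re) :
    ∫ t : ℝ in Ioi 0, (t : ℂ) ^ (z - 1) * Complex.exp (-(a * t)) =
      a ^ (-z) * Complex.Gamma z := by
  set U : Set ℂ := {a | 0 < a.re}
  have hU : IsOpen U := isOpen_lt continuous_const Complex.continuous_re
  have hUc : IsPreconnected U := (convex_halfSpace_re_gt 0).isPreconnected
  have h1 : AnalyticOnNhd ℂ (fun a : ℂ => ∫ t : ℝ in Ioi 0,
      (t : ℂ) ^ (z - 1) * Complex.exp (-(a * t))) U :=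
    DifferentiableOn.analyticOnNhd (fun b hb =>
      (differentiableAt_integral_cpow_mul_exp_neg_mul hz hb).differentiableWithinAt) hU
  have h2 : AnalyticOnNhd ℂ (fun a : ℂ => a ^ (-z) * Complex.Gamma z) U := by
    refine DifferentiableOn.analyticOnNhd (fun b hb => ?_) hU
    exact ((differentiableAt_id.cpow_const (Or.inl hb)).mul_const _).differentiableWithinAt
  refine h1.eqOn_of_preconnected_of_frequently_eq h2 hUc (z₀ := 1) (by simp [U]) ?_ ha
  have hreal : ∀ r : ℝ, 0 < r → ∫ t : ℝ in Ioi 0, (t : ℂ) ^ (z - 1) * Complex.exp (-(r * t)) =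
      (r : ℂ) ^ (-z) * Complex.Gamma z := by
    intro r hr
    rw [Complex.integral_cpow_mul_exp_neg_mul_Ioi hz hr, one_div, Complex.cpow_neg,
      Complex.inv_cpow]
    rw [Complex.arg_ofReal_of_nonneg hr.le]
    exact Real.pi_pos.ne
  have hten : Tendsto (fun r : ℝ => (r : ℂ)) (𝓝[>] 1) (𝓝[≠] 1) := by
    refine tendsto_nhdsWithin_iff.2 ⟨?_, ?_⟩
    · exact (Complex.continuous_ofReal.tendsto' 1 1 (by simp)).mono_left nhdsWithin_le_nhds
    · filter_upwards [self_mem_nhdsWithin] with r hr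
      simpa using (ne_of_gt hr)
  refine hten.frequently (Eventually.frequently ?_)
  filter_upwards [self_mem_nhdsWithin] with r hr
  exact hreal r (zero_lt_one.trans hr)

theorem image_exp_univ : Real.exp '' univ = Ioi 0 := by
  rw [image_univ, Real.range_exp]

theorem integral_Ioi_eq_integral_exp (g : ℝ → ℂ) :
    ∫ t in Ioi (0 : ℝ), g t = ∫ u : ℝ, (Real.exp u : ℂ) * g (Real.exp u) := by
  rw [← image_exp_univ, integral_image_eq_integral_abs_deriv_smul MeasurableSet.univ
    (fun x _ => (Real.hasDerivAt_exp x).hasDerivWithinAt) Real.exp_injective.injOn]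
  simp [abs_of_pos (Real.exp_pos _)]

theorem integrable_exp_mul_comp_exp {g : ℝ → ℂ} (hg : IntegrableOn g (Ioi 0)) :
    Integrable fun u : ℝ => (Real.exp u : ℂ) * g (Real.exp u) := by
  rw [← image_exp_univ, integrableOn_image_iff_integrableOn_abs_deriv_smul MeasurableSet.univ
    (fun x _ => (Real.hasDerivAt_exp x).hasDerivWithinAt) Real.exp_injective.injOn] at hg
  simpa [abs_of_pos (Real.exp_pos _)] using hg

theorem lintegral_Ioi_eq_lintegral_exp (g : ℝ → ℝ≥0∞) :
    ∫⁻ t in Ioi (0 : ℝ), g t = ∫⁻ u : ℝ, ENNReal.ofReal (Real.exp u) * g (Real.exp u) := by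
  rw [← image_exp_univ, lintegral_image_eq_lintegral_abs_deriv_mul MeasurableSet.univ
    (fun x _ => (Real.hasDerivAt_exp x).hasDerivWithinAt) Real.exp_injective.injOn]
  simp [abs_of_pos (Real.exp_pos _)]

theorem exp_mul_cpow_exp (z : ℂ) (u : ℝ) (w : ℂ) :
    (Real.exp u : ℂ) * ((Real.exp u : ℂ) ^ (z - 1) * w) = Complex.exp (z * u) * w := by
  have h : ((Real.exp u : ℝ) : ℂ) = Complex.exp u := by simp
  rw [← mul_assoc, Complex.cpow_def_of_ne_zero (by simp), ← Complex.ofReal_log (Real.exp_pos u).le,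
    Real.log_exp, h, ← Complex.exp_add]
  congr 2
  ring

/-- The kernel `exp (-i e ^ u)`, damped at both ends so as to be integrable. -/
noncomputable def dampedKernel (ε u : ℝ) : ℂ :=
  Complex.exp (ε * u - (ε + Complex.I) * Real.exp u)

theorem dampedKernel_mul_exp (ε p u : ℝ) :
    dampedKernel ε u * Complex.exp (-Complex.I * p * u) =
      (Real.exp u : ℂ) * ((Real.exp u : ℂ) ^ ((ε - Complex.I * p : ℂ) - 1) *
        Complex.exp (-((ε + Complex.I) * (Real.exp u : ℝ)))) := by
  rw [exp_mul_cpow_exp, dampedKernel, ← Complex.exp_add, ← Complex.exp_add]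
  congr 1
  ring

theorem integrable_dampedKernel {ε : ℝ} (hε : 0 < ε) : Integrable (dampedKernel ε) := by
  have h := integrable_exp_mul_comp_exp (integrableOn_cpow_mul_exp_neg_mul (z := ε)
    (a := ε + Complex.I) (by simpa) (by simpa))
  convert h using 2 with u
  simpa using dampedKernel_mul_exp ε 0 u

theorem continuous_dampedKernel (ε : ℝ) : Continuous (dampedKernel ε) := by
  unfold dampedKernel
  fun_prop

theorem norm_dampedKernel_le {ε : ℝ} (hε : 0 ≤ ε) (u : ℝ) : ‖dampedKernel ε u‖ ≤ 1 := by
  rw [dampedKernel, Complex.norm_exp, Real.exp_le_one_iff]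
  have : u ≤ Real.exp u := by linarith [Real.add_one_le_exp u]
  simp [-Complex.ofReal_exp]
  gcongr

theorem ft_dampedKernel {ε : ℝ} (hε : 0 < ε) (p : ℝ) :
    ft (dampedKernel ε) p = (Real.sqrt (2 * Real.pi) : ℂ)⁻¹ *
      ((ε + Complex.I) ^ (-(ε - Complex.I * p : ℂ)) * Complex.Gamma (ε - Complex.I * p)) := by
  rw [ft, ← integral_cpow_mul_exp_neg_mul (by simpa) (by simpa), integral_Ioi_eq_integral_exp]
  simp_rw [dampedKernel_mul_exp]

theorem norm_Gamma_le_Gamma_re {z : ℂ} (hz : 0 < z.re) : ‖Complex.Gamma z‖ ≤ Real.Gamma z.re := by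
  rw [Complex.Gamma_eq_integral hz, Complex.GammaIntegral, Real.Gamma_eq_integral hz]
  refine norm_integral_le_of_norm_le (Real.GammaIntegral_convergent hz) ?_
  refine (ae_restrict_iff' measurableSet_Ioi).2 (Eventually.of_forall fun t ht => ?_)
  rw [norm_mul, Complex.norm_cpow_eq_rpow_re_of_pos ht, Complex.norm_real, Real.norm_eq_abs,
    Real.abs_exp]
  simp

theorem norm_ft_dampedKernel_le {ε p : ℝ} (hε : 0 < ε) (hp : 0 < p) :
    ‖ft (dampedKernel ε) p‖ ≤ (Real.sqrt (2 * Real.pi))⁻¹ * (Real.Gamma (ε + 1) / p) := by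
  have ha0 : (ε + Complex.I : ℂ) ≠ 0 := fun h => by simpa using congrArg Complex.im h
  have ha1 : 1 ≤ ‖(ε + Complex.I : ℂ)‖ := by
    simpa using Complex.abs_im_le_norm (ε + Complex.I : ℂ)
  have harg : 0 ≤ (ε + Complex.I : ℂ).arg := by rw [Complex.arg_nonneg_iff]; simp
  have hz0 : (ε - Complex.I * p : ℂ) ≠ 0 := fun h => by
    have := congrArg Complex.re h
    simp at this
    exact hε.ne' this
  have hz1 : p ≤ ‖(ε - Complex.I * p : ℂ)‖ := by
    have := Complex.abs_im_le_norm (ε - Complex.I * p : ℂ)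
    simp at this
    exact (le_abs_self p).trans this
  have hG : ‖Complex.Gamma (ε - Complex.I * p)‖ ≤ Real.Gamma (ε + 1) / p := by
    have h1 := Complex.Gamma_add_one _ hz0
    have h2 := norm_Gamma_le_Gamma_re (z := ε - Complex.I * p + 1) (by simp; linarith)
    rw [h1, norm_mul] at h2
    simp at h2
    rw [le_div_iff₀ hp, mul_comm]
    exact (mul_le_mul_of_nonneg_right hz1 (norm_nonneg _)).trans h2
  have hc : ‖(ε + Complex.I : ℂ) ^ (-(ε - Complex.I * p : ℂ))‖ ≤ 1 := by
    rw [Complex.norm_cpow_of_ne_zero ha0]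
    refine div_le_one_of_le₀ ?_ (Real.exp_pos _).le
    refine (Real.rpow_le_one_of_one_le_of_nonpos ha1 (by simpa using hε.le)).trans ?_
    rw [Real.one_le_exp_iff]
    simpa using mul_nonneg harg hp.le
  rw [ft_dampedKernel hε, norm_mul, norm_mul, norm_inv, Complex.norm_real,
    Real.norm_of_nonneg (Real.sqrt_nonneg _)]
  gcongr
  calc _ ≤ 1 * ‖Complex.Gamma (ε - Complex.I * p)‖ := by gcongr
    _ ≤ _ := by rwa [one_mul]

/-- The Fourier transform of `exp (-i e ^ u)` away from the origin. -/
noncomputable def ftKernel (p : ℝ) : ℂ :=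
  (Real.sqrt (2 * Real.pi) : ℂ)⁻¹ *
    (Complex.I ^ (Complex.I * p : ℂ) * Complex.Gamma (-(Complex.I * p)))

theorem tendsto_ft_dampedKernel {p : ℝ} (hp : 0 < p) :
    Tendsto (fun ε => ft (dampedKernel ε) p) (𝓝[>] 0) (𝓝 (ftKernel p)) := by
  have h : Tendsto (fun ε : ℝ => (Real.sqrt (2 * Real.pi) : ℂ)⁻¹ *
      ((ε + Complex.I) ^ (-(ε - Complex.I * p : ℂ)) * Complex.Gamma (ε - Complex.I * p)))
      (𝓝 0) (𝓝 (ftKernel p)) := by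
    have h1 : Tendsto (fun ε : ℝ => (ε + Complex.I : ℂ)) (𝓝 0) (𝓝 Complex.I) :=
      Continuous.tendsto' (by fun_prop) _ _ (by simp)
    have h2 : Tendsto (fun ε : ℝ => -(ε - Complex.I * p : ℂ)) (𝓝 0) (𝓝 (Complex.I * p)) :=
      Continuous.tendsto' (by fun_prop) _ _ (by simp)
    have h3 : Tendsto (fun ε : ℝ => (ε - Complex.I * p : ℂ)) (𝓝 0) (𝓝 (-(Complex.I * p))) :=
      Continuous.tendsto' (by fun_prop) _ _ (by simp)
    have h4 : ContinuousAt Complex.Gamma (-(Complex.I * p)) := by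
      refine Complex.continuousAt_Gamma _ fun m hm => ?_
      have := congrArg Complex.im hm
      simp at this
      exact hp.ne' this
    exact ((h1.cpow h2 (by simp [Complex.slitPlane])).mul (h4.tendsto.comp h3)).const_mul _
  refine (h.mono_left nhdsWithin_le_nhds).congr' ?_
  filter_upwards [self_mem_nhdsWithin] with ε hε
  rw [ft_dampedKernel hε]

theorem norm_Gamma_neg_I_mul_sq {p : ℝ} (hp : 0 < p) :
    ‖Complex.Gamma (-(Complex.I * p))‖ ^ 2 = Real.pi / (p * Real.sinh (Real.pi * p)) := by
  set z : ℂ := -(Complex.I * p) with hz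
  have hp0 : (p : ℂ) ≠ 0 := by exact_mod_cast hp.ne'
  have hz0 : -z ≠ 0 := by simp [hz, hp0]
  have h1 := Complex.Gamma_mul_Gamma_one_sub z
  have h2 : Complex.Gamma (1 - z) = -z * Complex.Gamma (-z) := by
    rw [← Complex.Gamma_add_one _ hz0]; congr 1; ring
  have h3 : -z = (starRingEnd ℂ) z := by simp [hz]
  have hs : Complex.sin (Real.pi * z) = -(Real.sinh (Real.pi * p) * Complex.I) := by
    rw [hz, show (Real.pi : ℂ) * -(Complex.I * p) = -((Real.pi * p : ℂ) * Complex.I) by ring,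
      Complex.sin_neg, Complex.sin_mul_I]
    push_cast
    rfl
  have h4 := congrArg norm h1
  rw [h2, h3, Complex.Gamma_conj, hs, ← h3] at h4
  have hsinh : 0 < Real.sinh (Real.pi * p) := Real.sinh_pos_iff.2 (by positivity)
  simp only [norm_mul, norm_neg, norm_div, Complex.norm_real, Complex.norm_I, RCLike.norm_conj,
    mul_one, Real.norm_of_nonneg Real.pi_pos.le, Real.norm_of_nonneg hsinh.le] at h4
  have h5 : ‖z‖ = p := by simp [hz, abs_of_pos hp]
  rw [h5] at h4
  rw [eq_div_iff (by positivity)]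
  rw [eq_div_iff (by positivity)] at h4
  linarith

theorem norm_ftKernel_sq {p : ℝ} (hp : 0 < p) :
    ‖ftKernel p‖ ^ 2 = 1 / (p * (Real.exp (2 * Real.pi * p) - 1)) := by
  have hI : ‖Complex.I ^ (Complex.I * p : ℂ)‖ ^ 2 = Real.exp (-(Real.pi * p)) := by
    rw [Complex.norm_cpow_of_ne_zero Complex.I_ne_zero]
    simp [Complex.arg_I, ← Real.exp_neg, ← Real.exp_nat_mul]
    ring
  have he : 1 < Real.exp (2 * Real.pi * p) := Real.one_lt_exp_iff.2 (by positivity)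
  have hsinh : Real.sinh (Real.pi * p) =
      Real.exp (-(Real.pi * p)) * (Real.exp (2 * Real.pi * p) - 1) / 2 := by
    rw [Real.sinh_eq, mul_sub, ← Real.exp_add]
    ring_nf
  rw [ftKernel, norm_mul, norm_mul, mul_pow, mul_pow, hI, norm_Gamma_neg_I_mul_sq hp, hsinh,
    norm_inv, Complex.norm_real, Real.norm_of_nonneg (Real.sqrt_nonneg _), inv_pow,
    Real.sq_sqrt (by positivity)]
  have h1 : Real.exp (2 * Real.pi * p) - 1 ≠ 0 := by linarith
  have := Real.pi_pos.ne'
  field_simp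

theorem eLpNorm_two_sq {μ : Measure ℝ} (g : ℝ → ℂ) : eLpNorm g 2 μ ^ 2 = ∫⁻ x, ‖g x‖ₑ ^ 2 ∂μ := by
  have h := eLpNorm_nnreal_pow_eq_lintegral (f := g) (μ := μ) (p := 2) two_ne_zero
  have e : ((2 : NNReal) : ℝ) = ((2 : ℕ) : ℝ) := by simp
  rw [ENNReal.coe_ofNat] at h
  simpa only [e, ENNReal.rpow_natCast] using h

/-- A sequence of functions which is, up to a factor, isometric in `L²` to a convergent sequence
has the expected norm of its pointwise limit. -/
theorem eLpNorm_eq_of_tendsto {μ ν : Measure ℝ} {G H : ℕ → ℝ → ℂ} {g h : ℝ → ℂ} {c : ℝ≥0∞}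
    (hc : c ≠ ⊤) (hG : ∀ n, AEStronglyMeasurable (G n) μ) (hg : AEStronglyMeasurable g μ)
    (hH : ∀ n, AEStronglyMeasurable (H n) ν) (hh : AEStronglyMeasurable h ν)
    (hlim : ∀ x, Tendsto (fun n => G n x) atTop (𝓝 (g x)))
    (hHlim : Tendsto (fun n => eLpNorm (H n - h) 2 ν) atTop (𝓝 0))
    (h1 : ∀ n, eLpNorm (G n) 2 μ = c * eLpNorm (H n) 2 ν)
    (h2 : ∀ n m, eLpNorm (G n - G m) 2 μ = c * eLpNorm (H n - H m) 2 ν) :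
    eLpNorm g 2 μ = c * eLpNorm h 2 ν := by
  have hsub : ∀ n, eLpNorm (g - G n) 2 μ ≤ c * eLpNorm (H n - h) 2 ν := by
    intro n
    have hF := Lp.eLpNorm_lim_le_liminf_eLpNorm (p := 2) (μ := μ) (f := fun m => G m - G n)
      (fun m => (hG m).sub (hG n)) (g - G n)
      (Eventually.of_forall fun x => (hlim x).sub tendsto_const_nhds)
    refine hF.trans ?_
    have hb : Tendsto (fun m => c * (eLpNorm (H m - h) 2 ν + eLpNorm (H n - h) 2 ν)) atTop
        (𝓝 (c * (0 + eLpNorm (H n - h) 2 ν))) :=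
      ENNReal.Tendsto.const_mul (hHlim.add tendsto_const_nhds) (Or.inr hc)
    rw [zero_add] at hb
    rw [← hb.liminf_eq]
    refine liminf_le_liminf (Eventually.of_forall fun m => ?_)
    simp only [h2]
    gcongr
    have := eLpNorm_sub_le ((hH m).sub hh) ((hH n).sub hh) (p := 2) (by norm_num)
    simpa using this
  have hz : Tendsto (fun n => c * eLpNorm (H n - h) 2 ν) atTop (𝓝 0) := by
    simpa using ENNReal.Tendsto.const_mul hHlim (Or.inr hc)
  apply le_antisymm
  · have hb : Tendsto (fun n => c * eLpNorm (H n - h) 2 ν + c * eLpNorm h 2 ν) atTop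
        (𝓝 (0 + c * eLpNorm h 2 ν)) := hz.add tendsto_const_nhds
    rw [zero_add] at hb
    refine (Lp.eLpNorm_lim_le_liminf_eLpNorm hG g (Eventually.of_forall hlim)).trans ?_
    rw [← hb.liminf_eq]
    refine liminf_le_liminf (Eventually.of_forall fun n => ?_)
    simp only [h1, ← mul_add]
    gcongr
    have := eLpNorm_add_le ((hH n).sub hh) hh (p := 2) (by norm_num)
    simpa using this
  · have hb : Tendsto (fun n => eLpNorm g 2 μ + c * eLpNorm (H n - h) 2 ν +
        c * eLpNorm (H n - h) 2 ν) atTop (𝓝 (eLpNorm g 2 μ + 0 + 0)) :=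
      (tendsto_const_nhds.add hz).add hz
    rw [add_zero, add_zero] at hb
    refine ge_of_tendsto hb (Eventually.of_forall fun n => ?_)
    have e1 : eLpNorm h 2 ν ≤ eLpNorm (H n) 2 ν + eLpNorm (H n - h) 2 ν := by
      have := eLpNorm_sub_le (hH n) ((hH n).sub hh) (p := 2) (by norm_num)
      simpa using this
    have e2 : eLpNorm (G n) 2 μ ≤ eLpNorm g 2 μ + eLpNorm (g - G n) 2 μ := by
      have := eLpNorm_sub_le hg (hg.sub (hG n)) (p := 2) (by norm_num)
      simpa using this
    calc c * eLpNorm h 2 ν ≤ c * (eLpNorm (H n) 2 ν + eLpNorm (H n - h) 2 ν) := by gcongr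
      _ = eLpNorm (G n) 2 μ + c * eLpNorm (H n - h) 2 ν := by rw [mul_add, h1]
      _ ≤ _ := by
        gcongr
        exact e2.trans (by gcongr; exact hsub n)

theorem continuous_integral_mul_dampedKernel_sub {f : ℝ → ℂ} (hf : Integrable f) {ε : ℝ}
    (hε : 0 ≤ ε) : Continuous fun s => ∫ y, f y * dampedKernel ε (s - y) := by
  refine continuous_of_dominated (bound := fun y => ‖f y‖) (fun s => ?_) (fun s => ?_) hf.norm ?_
  · exact hf.aestronglyMeasurable.mul
      ((continuous_dampedKernel ε).comp (by fun_prop)).aestronglyMeasurable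
  · refine Eventually.of_forall fun y => ?_
    rw [norm_mul]
    exact mul_le_of_le_one_right (norm_nonneg _) (norm_dampedKernel_le hε _)
  · refine Eventually.of_forall fun y => ?_
    exact continuous_const.mul ((continuous_dampedKernel ε).comp (by fun_prop))

theorem tendsto_integral_mul_dampedKernel_sub {f : ℝ → ℂ} (hf : Integrable f) {ε : ℕ → ℝ}
    (hε : ∀ n, 0 < ε n) (hε0 : Tendsto ε atTop (𝓝 0)) (s : ℝ) :
    Tendsto (fun n => ∫ y, f y * dampedKernel (ε n) (s - y)) atTop
      (𝓝 (∫ y, f y * dampedKernel 0 (s - y))) := by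
  refine tendsto_integral_of_dominated_convergence (fun y => ‖f y‖) (fun n => ?_) hf.norm
    (fun n => ?_) ?_
  · exact hf.aestronglyMeasurable.mul
      ((continuous_dampedKernel _).comp (by fun_prop)).aestronglyMeasurable
  · refine Eventually.of_forall fun y => ?_
    rw [norm_mul]
    exact mul_le_of_le_one_right (norm_nonneg _) (norm_dampedKernel_le (hε n).le _)
  · refine Eventually.of_forall fun y => ?_
    have : Continuous fun e : ℝ => dampedKernel e (s - y) := by unfold dampedKernel; fun_prop
    exact ((this.tendsto 0).comp hε0).const_mul _

theorem ft_sub {f g : ℝ → ℂ} (hf : Integrable f) (hg : Integrable g) (p : ℝ) :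
    ft (f - g) p = ft f p - ft g p := by
  have hi : ∀ {f : ℝ → ℂ}, Integrable f →
      Integrable fun y : ℝ => f y * Complex.exp (-Complex.I * p * y) := fun {f} hf => by
    refine hf.mul_bdd (c := 1) (by fun_prop) (Eventually.of_forall fun y => ?_)
    simp [Complex.norm_exp]
  simp only [ft, ← mul_sub, Pi.sub_apply, sub_mul]
  rw [integral_sub (hi hf) (hi hg)]

theorem lintegral_eq_setLIntegral_Ioi {u : ℝ → ℝ≥0∞} (hu : ∀ᵐ p : ℝ, p ≤ 0 → u p = 0) :
    ∫⁻ p, u p = ∫⁻ p in Ioi 0, u p := by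
  rw [← lintegral_indicator measurableSet_Ioi]
  refine lintegral_congr_ae ?_
  filter_upwards [hu] with p hp
  by_cases h : 0 < p
  · simp [h]
  · simp [h, hp (not_lt.1 h)]

theorem lintegral_enorm_integral_mul_dampedKernel_sub_sq {f : ℝ → ℂ} (hf : Integrable f)
    (hfp : ∀ᵐ p : ℝ, p ≤ 0 → ft f p = 0)
    (hD : ∫⁻ p in Ioi 0, ‖ft f p‖ₑ ^ 2 * ENNReal.ofReal (1 / p ^ 2) ≠ ⊤) :
    ∫⁻ s, ‖∫ y, f y * dampedKernel 0 (s - y)‖ₑ ^ 2 =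
      ENNReal.ofReal (2 * Real.pi) * ∫⁻ p in Ioi 0, ‖ft f p * ftKernel p‖ₑ ^ 2 := by
  set ε : ℕ → ℝ := fun n => 1 / ((n : ℝ) + 1) with hεdef
  have hε : ∀ n, 0 < ε n := fun n => by positivity
  have hε1 : ∀ n, ε n ≤ 1 := fun n => by
    rw [hεdef]
    refine div_le_one_of_le₀ ?_ (by positivity)
    linarith [n.cast_nonneg (α := ℝ)]
  have hε0 : Tendsto ε atTop (𝓝 0) := tendsto_one_div_add_atTop_nhds_zero_nat
  have hK := fun n => integrable_dampedKernel (hε n)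
  set c : ℝ≥0∞ := ‖(Real.sqrt (2 * Real.pi) : ℂ)‖ₑ with hcdef
  have hsq : ∀ {a b : ℝ≥0∞}, a ^ 2 = c ^ 2 * b ^ 2 → a = c * b := fun {a b} h => by
    rw [← mul_pow] at h
    exact (ENNReal.pow_right_strictMono two_ne_zero).injective h
  have hH : ∀ n, Continuous fun p => ft f p * ft (dampedKernel (ε n)) p := fun n =>
    (continuous_ft hf).mul (continuous_ft (hK n))
  have hHp : ∀ p ∈ Ioi (0 : ℝ), Tendsto (fun n => ft f p * ft (dampedKernel (ε n)) p) atTop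
      (𝓝 (ft f p * ftKernel p)) := fun p hp =>
    ((tendsto_ft_dampedKernel hp).comp (tendsto_nhdsWithin_iff.2
      ⟨hε0, Eventually.of_forall hε⟩)).const_mul _
  have hHae := (ae_restrict_iff' (μ := volume) measurableSet_Ioi).2 (Eventually.of_forall hHp)
  have hh : AEStronglyMeasurable (fun p => ft f p * ftKernel p) (volume.restrict (Ioi 0)) :=
    aestronglyMeasurable_of_tendsto_ae atTop
      (fun n => (hH n).aestronglyMeasurable) hHae
  obtain ⟨B, hB⟩ : ∃ B : ℝ, ∀ n, Real.Gamma (ε n + 1) ≤ B := by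
    have : ContinuousOn Real.Gamma (Icc 1 2) := fun x hx =>
      (Real.differentiableAt_Gamma fun m hm => by
        have := hx.1
        have h0 := m.cast_nonneg (α := ℝ)
        linarith).continuousAt.continuousWithinAt
    obtain ⟨B, hB⟩ := isCompact_Icc.bddAbove_image this
    exact ⟨B, fun n => hB ⟨_, ⟨by linarith [hε n], by linarith [hε1 n]⟩, rfl⟩⟩
  set C : ℝ := (Real.sqrt (2 * Real.pi))⁻¹ * B
  have hHb : ∀ n, ∀ p ∈ Ioi (0 : ℝ), ‖ft f p * ft (dampedKernel (ε n)) p‖ ≤ ‖ft f p‖ * (C / p) := by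
    intro n p hp
    rw [norm_mul]
    gcongr
    refine (norm_ft_dampedKernel_le (hε n) hp).trans ?_
    have hp0 : 0 < p := hp
    rw [mul_div_assoc]
    gcongr
    exact hB n
  have hdiff : ∀ n, ∀ p ∈ Ioi (0 : ℝ),
      ‖ft f p * ft (dampedKernel (ε n)) p - ft f p * ftKernel p‖ ≤ ‖ft f p‖ * (2 * C / p) := by
    intro n p hp
    have h1 := le_of_tendsto (hHp p hp).norm (Eventually.of_forall fun n => hHb n p hp)
    refine (norm_sub_le _ _).trans ((add_le_add (hHb n p hp) h1).trans_eq (by ring))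
  have hHlim : Tendsto (fun n => eLpNorm ((fun p => ft f p * ft (dampedKernel (ε n)) p) -
      fun p => ft f p * ftKernel p) 2 (volume.restrict (Ioi 0))) atTop (𝓝 0) := by
    have hl : Tendsto (fun n => ∫⁻ p in Ioi 0,
        ‖ft f p * ft (dampedKernel (ε n)) p - ft f p * ftKernel p‖ₑ ^ 2) atTop
        (𝓝 (∫⁻ p in Ioi (0 : ℝ), 0)) := by
      refine tendsto_lintegral_of_dominated_convergence' (fun p => ENNReal.ofReal ((2 * C) ^ 2) *
        (‖ft f p‖ₑ ^ 2 * ENNReal.ofReal (1 / p ^ 2))) (fun n => ?_) (fun n => ?_) ?_ ?_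
      · exact ((hH n).aestronglyMeasurable.sub hh).enorm.pow_const 2
      · refine (ae_restrict_iff' measurableSet_Ioi).2 (Eventually.of_forall fun p hp => ?_)
        have hp0 : 0 < p := hp
        have := hdiff n p hp
        beta_reduce
        rw [← ofReal_norm, ← ofReal_norm, ← ENNReal.ofReal_pow (norm_nonneg _),
          ← ENNReal.ofReal_pow (norm_nonneg _), ← ENNReal.ofReal_mul (by positivity),
          ← ENNReal.ofReal_mul (by positivity)]
        refine ENNReal.ofReal_le_ofReal ?_
        calc _ ≤ (‖ft f p‖ * (2 * C / p)) ^ 2 := by gcongr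
          _ = _ := by ring
      · rw [lintegral_const_mul' _ _ ENNReal.ofReal_ne_top]
        exact ENNReal.mul_ne_top ENNReal.ofReal_ne_top hD
      · filter_upwards [hHae] with p hp
        have h1 : Tendsto (fun n => ft f p * ft (dampedKernel (ε n)) p - ft f p * ftKernel p)
            atTop (𝓝 0) := by simpa using hp.sub_const (ft f p * ftKernel p)
        simpa [Function.comp_def] using (ENNReal.continuous_pow 2).tendsto _ |>.comp h1.enorm
    rw [lintegral_zero] at hl
    have h2 : Tendsto (fun n => (eLpNorm ((fun p => ft f p * ft (dampedKernel (ε n)) p) -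
      fun p => ft f p * ftKernel p) 2 (volume.restrict (Ioi 0)) ^ 2) ^ (2⁻¹ : ℝ)) atTop
      (𝓝 (0 ^ (2⁻¹ : ℝ))) := by
      simp_rw [eLpNorm_two_sq]
      exact (ENNReal.continuous_rpow_const.tendsto 0).comp hl
    rw [ENNReal.zero_rpow_of_pos (by norm_num)] at h2
    refine h2.congr fun n => ?_
    rw [← ENNReal.rpow_natCast, ← ENNReal.rpow_mul]
    norm_num
  have key := eLpNorm_eq_of_tendsto (μ := volume) (ν := volume.restrict (Ioi 0)) (c := c)
    (G := fun n s => ∫ y, f y * dampedKernel (ε n) (s - y))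
    (g := fun s => ∫ y, f y * dampedKernel 0 (s - y))
    (H := fun n p => ft f p * ft (dampedKernel (ε n)) p)
    (h := fun p => ft f p * ftKernel p) enorm_ne_top
    (fun n => (continuous_integral_mul_dampedKernel_sub hf (hε n).le).aestronglyMeasurable)
    (continuous_integral_mul_dampedKernel_sub hf le_rfl).aestronglyMeasurable
    (fun n => (hH n).aestronglyMeasurable) hh
    (fun s => tendsto_integral_mul_dampedKernel_sub hf hε hε0 s) hHlim (fun n => hsq ?_)
    (fun n m => hsq ?_)
  · rw [← eLpNorm_two_sq, key, mul_pow, hcdef, enorm_sqrt_two_pi_sq, eLpNorm_two_sq]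
  · rw [eLpNorm_two_sq, eLpNorm_two_sq, hcdef, enorm_sqrt_two_pi_sq,
      lintegral_enorm_integral_mul_comp_sub_sq hf (hK n) (norm_dampedKernel_le (hε n).le)]
    congr 1
    refine lintegral_eq_setLIntegral_Ioi ?_
    filter_upwards [hfp] with p hp h
    simp [hp h]
  · have hi : ∀ k s, Integrable fun y => f y * dampedKernel (ε k) (s - y) := fun k s => by
      refine hf.mul_bdd (c := 1)
        ((continuous_dampedKernel _).comp (by fun_prop)).aestronglyMeasurable
        (Eventually.of_forall fun y => norm_dampedKernel_le (hε k).le _)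
    have e := lintegral_enorm_integral_mul_comp_sub_sq (C := 2) hf ((hK n).sub (hK m)) (fun u => by
      have h1 := norm_dampedKernel_le (hε n).le u
      have h2 := norm_dampedKernel_le (hε m).le u
      exact (norm_sub_le _ _).trans (by linarith))
    rw [eLpNorm_two_sq, eLpNorm_two_sq, hcdef, enorm_sqrt_two_pi_sq]
    simp only [Pi.sub_apply, mul_sub] at e ⊢
    simp_rw [ft_sub (hK n) (hK m), integral_sub (hi n _) (hi m _), mul_sub] at e
    rw [e]
    congr 1
    refine lintegral_eq_setLIntegral_Ioi ?_
    filter_upwards [hfp] with p hp h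
    simp [hp h]

theorem No_xR_eq (f : ℝ → ℂ) :
    No xR f = ENNReal.ofReal (1 / (4 * Real.pi)) *
      ∫⁻ s, ‖∫ y, f y * dampedKernel 0 (s - y)‖ₑ ^ 2 := by
  rw [No, lintegral_Ioi_eq_lintegral_exp, ← lintegral_const_mul' _ _ ENNReal.ofReal_ne_top]
  refine lintegral_congr fun s => ?_
  have e : Fk xR f (-Real.exp s) = (Real.sqrt (2 * Real.pi) : ℂ)⁻¹ *
      ∫ y, f y * dampedKernel 0 (s - y) := by
    rw [Fk]
    congr 2 with y
    rw [dampedKernel, xR, sub_eq_add_neg s y, Real.exp_add]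
    push_cast
    ring_nf
  rw [e, norm_mul, mul_pow, norm_inv, Complex.norm_real, Real.norm_of_nonneg (Real.sqrt_nonneg _),
    inv_pow, Real.sq_sqrt (by positivity), ← ofReal_norm, ← ENNReal.ofReal_pow (norm_nonneg _),
    ← ENNReal.ofReal_mul (by positivity), ← ENNReal.ofReal_mul (by positivity)]
  congr 1
  have := (Real.exp_pos s).ne'
  field_simp
  ring

theorem Nth_two_pi_eq (f : ℝ → ℂ) :
    Nth (2 * Real.pi) f =
      ENNReal.ofReal (1 / 2) * ∫⁻ p in Ioi 0, ‖ft f p * ftKernel p‖ₑ ^ 2 := by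
  rw [Nth, ← lintegral_const_mul' _ _ ENNReal.ofReal_ne_top]
  refine setLIntegral_congr_fun measurableSet_Ioi fun p hp => ?_
  rw [← ofReal_norm, ← ENNReal.ofReal_pow (norm_nonneg _), ← ENNReal.ofReal_mul (by positivity),
    norm_mul, mul_pow, norm_ftKernel_sq hp, mul_assoc 2 p]
  congr 1
  generalize p * (Real.exp (2 * Real.pi * p) - 1) = x
  ring

theorem No_xR_eq_Nth_of_ne_top {f : ℝ → ℂ} (hf : Integrable f)
    (hfp : ∀ᵐ p : ℝ, p ≤ 0 → ft f p = 0)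
    (hD : ∫⁻ p in Ioi 0, ‖ft f p‖ₑ ^ 2 * ENNReal.ofReal (1 / p ^ 2) ≠ ⊤) :
    No xR f = Nth (2 * Real.pi) f := by
  rw [No_xR_eq, Nth_two_pi_eq, lintegral_enorm_integral_mul_dampedKernel_sub_sq hf hfp hD,
    ← mul_assoc, ← ENNReal.ofReal_mul (by positivity)]
  congr 2
  have := Real.pi_pos.ne'
  field_simp
  norm_num

theorem lintegral_enorm_ft_sq_div_sq_ne_top {f : ℝ → ℂ}
    (h : ∫⁻ p in Ioc 0 1, ‖ft f p‖ₑ ^ 2 * ENNReal.ofReal (1 / p ^ 2) ≠ ⊤) :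
    ∫⁻ p in Ioi 0, ‖ft f p‖ₑ ^ 2 * ENNReal.ofReal (1 / p ^ 2) ≠ ⊤ := by
  rw [← Ioc_union_Ioi_eq_Ioi (zero_le_one (α := ℝ)),
    lintegral_union measurableSet_Ioi (Ioc_disjoint_Ioi le_rfl)]
  refine ENNReal.add_ne_top.2 ⟨h, ?_⟩
  set M : ℝ := (Real.sqrt (2 * Real.pi))⁻¹ * ∫ y, ‖f y‖
  have hi : IntegrableOn (fun p : ℝ => p ^ (-2 : ℝ)) (Ioi 1) :=
    integrableOn_Ioi_rpow_of_lt (by norm_num) one_pos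
  refine ne_top_of_le_ne_top (ENNReal.mul_ne_top (ENNReal.ofReal_ne_top (r := M ^ 2))
    hi.lintegral_lt_top.ne) ?_
  rw [← lintegral_const_mul' _ _ ENNReal.ofReal_ne_top]
  refine setLIntegral_mono' measurableSet_Ioi fun p hp => ?_
  have hp0 : (0 : ℝ) < p := zero_lt_one.trans hp
  have e : p ^ (-2 : ℝ) = 1 / p ^ 2 := by
    rw [Real.rpow_neg hp0.le, one_div]
    norm_num
  rw [e, ← ofReal_norm, ← ENNReal.ofReal_pow (norm_nonneg _)]
  gcongr
  exact norm_ft_le f p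

theorem lintegral_enorm_ft_sq_div_sq_ne_top_of_thermal {f : ℝ → ℂ}
    (h : ∫⁻ p in Ioc 0 1,
      ENNReal.ofReal (‖ft f p‖ ^ 2 / (2 * p * (Real.exp (2 * Real.pi * p) - 1))) ≠ ⊤) :
    ∫⁻ p in Ioi 0, ‖ft f p‖ₑ ^ 2 * ENNReal.ofReal (1 / p ^ 2) ≠ ⊤ := by
  refine lintegral_enorm_ft_sq_div_sq_ne_top (ne_top_of_le_ne_top (ENNReal.mul_ne_top
    (ENNReal.ofReal_ne_top (r := 4 * Real.pi * Real.exp (2 * Real.pi))) h) ?_)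
  rw [← lintegral_const_mul' _ _ ENNReal.ofReal_ne_top]
  refine setLIntegral_mono' measurableSet_Ioc fun p hp => ?_
  obtain ⟨hp0, hp1⟩ := hp
  rw [← ofReal_norm, ← ENNReal.ofReal_pow (norm_nonneg _), ← ENNReal.ofReal_mul (by positivity),
    ← ENNReal.ofReal_mul (by positivity)]
  refine ENNReal.ofReal_le_ofReal ?_
  have h1 : 0 < Real.exp (2 * Real.pi * p) - 1 := by
    have : 1 < Real.exp (2 * Real.pi * p) := Real.one_lt_exp_iff.2 (by positivity)
    linarith
  have h2 : Real.exp (2 * Real.pi * p) - 1 ≤ 2 * Real.pi * p * Real.exp (2 * Real.pi) := by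
    have h3 := Real.add_one_le_exp (-(2 * Real.pi * p))
    have h4 : Real.exp (-(2 * Real.pi * p)) * Real.exp (2 * Real.pi * p) = 1 := by
      rw [← Real.exp_add]; simp
    have h5 : Real.exp (2 * Real.pi * p) ≤ Real.exp (2 * Real.pi) := by
      refine Real.exp_le_exp.2 (mul_le_of_le_one_right (by positivity) hp1)
    have h6 : 2 * Real.pi * p * Real.exp (2 * Real.pi * p) ≤
      2 * Real.pi * p * Real.exp (2 * Real.pi) := by gcongr
    nlinarith [Real.exp_pos (2 * Real.pi * p)]
  rw [mul_one_div, mul_div_assoc', div_le_div_iff₀ (by positivity) (by positivity)]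
  calc ‖ft f p‖ ^ 2 * (2 * p * (Real.exp (2 * Real.pi * p) - 1))
      ≤ ‖ft f p‖ ^ 2 * (2 * p * (2 * Real.pi * p * Real.exp (2 * Real.pi))) := by gcongr
    _ = _ := by ring

theorem ft_tr (f : ℝ → ℂ) (h p : ℝ) : ft (tr f h) p = ft f p * Complex.exp (-Complex.I * p * h) := by
  rw [ft, ft, mul_assoc, ← integral_mul_const,
    ← integral_sub_right_eq_self (fun y : ℝ => f y * Complex.exp (-Complex.I * p * y) *
      Complex.exp (-Complex.I * p * h)) h]
  congr 2 with y
  rw [tr, mul_assoc (f (y - h)), ← Complex.exp_add]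
  congr 2
  push_cast
  ring

theorem ft_sub_tr {f : ℝ → ℂ} (hf : Integrable f) (h p : ℝ) :
    ft (f - tr f h) p = ft f p * (1 - Complex.exp (-Complex.I * p * h)) := by
  rw [ft_sub hf (g := tr f h) (hf.comp_sub_right h), ft_tr]
  ring

theorem No_xR_sub_tr_le {f : ℝ → ℂ} (hf : Integrable f) (h : ℝ) :
    No xR (f - tr f h) ≤ 4 * No xR f := by
  set G : ℝ → ℂ := fun s => ∫ y, f y * dampedKernel 0 (s - y)
  have hG : Continuous G := continuous_integral_mul_dampedKernel_sub hf le_rfl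
  have hi : ∀ g : ℝ → ℂ, Integrable g → ∀ s, Integrable fun y => g y * dampedKernel 0 (s - y) :=
    fun g hg s => hg.mul_bdd (c := 1)
      ((continuous_dampedKernel _).comp (by fun_prop)).aestronglyMeasurable
      (Eventually.of_forall fun y => norm_dampedKernel_le le_rfl _)
  have e : (fun s => ∫ y, (f - tr f h) y * dampedKernel 0 (s - y)) = G - fun s => G (s - h) := by
    ext s
    simp only [Pi.sub_apply, sub_mul]
    rw [integral_sub (hi f hf s) (hi (tr f h) (hf.comp_sub_right h) s)]
    congr 1
    change _ = ∫ y, f y * dampedKernel 0 (s - h - y)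
    rw [← integral_sub_right_eq_self (fun y => f y * dampedKernel 0 (s - h - y)) h]
    congr 1 with y
    rw [tr]
    congr 2
    ring
  have hN : eLpNorm (fun s => G (s - h)) 2 volume = eLpNorm G 2 volume :=
    eLpNorm_comp_measurePreserving hG.aestronglyMeasurable (measurePreserving_sub_right volume h)
  have ht : eLpNorm (G - fun s => G (s - h)) 2 volume ≤ 2 * eLpNorm G 2 volume := by
    refine (eLpNorm_sub_le (g := fun s => G (s - h)) hG.aestronglyMeasurable
      (hG.comp (by fun_prop)).aestronglyMeasurable (by norm_num)).trans_eq ?_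
    rw [hN, two_mul]
  rw [No_xR_eq, No_xR_eq, ← eLpNorm_two_sq, ← eLpNorm_two_sq, e, mul_left_comm]
  gcongr
  calc _ ≤ (2 * eLpNorm G 2 volume) ^ 2 := by gcongr
    _ = 4 * eLpNorm G 2 volume ^ 2 := by rw [mul_pow]; norm_num

theorem norm_one_sub_exp_le (x : ℝ) : ‖1 - Complex.exp (-Complex.I * x)‖ ≤ |x| := by
  have h := Real.norm_exp_I_mul_ofReal_sub_one_le (x := -x)
  rw [norm_sub_rev]
  simpa using h

theorem setLIntegral_thermal_mul_le {f : ℝ → ℂ} (hf : Integrable f)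
    (hfp : ∀ᵐ p : ℝ, p ≤ 0 → ft f p = 0) (h : ℝ) :
    ∫⁻ p in Ioc 0 1, ENNReal.ofReal (‖ft f p‖ ^ 2 / (2 * p * (Real.exp (2 * Real.pi * p) - 1))) *
      ENNReal.ofReal (‖1 - Complex.exp (-Complex.I * p * h)‖ ^ 2) ≤ 4 * No xR f := by
  have hg : Integrable (f - tr f h) := hf.sub (hf.comp_sub_right h)
  have hD : ∫⁻ p in Ioi 0, ‖ft (f - tr f h) p‖ₑ ^ 2 * ENNReal.ofReal (1 / p ^ 2) ≠ ⊤ := by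
    refine lintegral_enorm_ft_sq_div_sq_ne_top ?_
    set M : ℝ := (Real.sqrt (2 * Real.pi))⁻¹ * ∫ y, ‖f y‖
    have hc : ∫⁻ _ in Ioc (0 : ℝ) 1, ENNReal.ofReal ((M * |h|) ^ 2) ≠ ⊤ := by simp
    refine ne_top_of_le_ne_top hc (setLIntegral_mono' measurableSet_Ioc fun p hp => ?_)
    have hp0 : 0 < p := hp.1
    have hb : ‖ft (f - tr f h) p‖ ≤ M * (p * |h|) := by
      rw [ft_sub_tr hf, norm_mul]
      have := norm_one_sub_exp_le (p * h)
      rw [abs_mul, abs_of_pos hp0] at this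
      push_cast at this
      rw [← mul_assoc] at this
      exact mul_le_mul (norm_ft_le f p) this (norm_nonneg _) (by positivity)
    rw [← ofReal_norm, ← ENNReal.ofReal_pow (norm_nonneg _), ← ENNReal.ofReal_mul (by positivity)]
    refine ENNReal.ofReal_le_ofReal ?_
    calc _ ≤ (M * (p * |h|)) ^ 2 * (1 / p ^ 2) := by gcongr
      _ = _ := by field_simp
  have key := No_xR_eq_Nth_of_ne_top hg (by
    filter_upwards [hfp] with p hp hp0
    rw [ft_sub_tr hf, hp hp0, zero_mul]) hD
  refine le_trans ?_ (No_xR_sub_tr_le hf h)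
  rw [key, Nth]
  refine (le_of_eq ?_).trans (lintegral_mono_set
    (Ioc_subset_Ioi_self : Ioc (0 : ℝ) 1 ⊆ Ioi 0))
  refine setLIntegral_congr_fun measurableSet_Ioc fun p hp => ?_
  have h1 : 0 ≤ Real.exp (2 * Real.pi * p) - 1 := by
    have : 1 ≤ Real.exp (2 * Real.pi * p) :=
      Real.one_le_exp (mul_nonneg (by positivity) hp.1.le)
    linarith
  have hp0 := hp.1.le
  rw [← ENNReal.ofReal_mul (by positivity), ft_sub_tr hf, norm_mul]
  congr 1
  ring

theorem eventually_le_sum_norm_one_sub_pow_sq {z : ℂ} (hz : ‖z‖ = 1) (hz1 : z ≠ 1) :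
    ∀ᶠ N : ℕ in atTop, (N : ℝ) ≤ ∑ j ∈ Finset.range N, ‖1 - z ^ j‖ ^ 2 := by
  have hd : 0 < ‖z - 1‖ := norm_pos_iff.2 (sub_ne_zero.2 hz1)
  filter_upwards [tendsto_natCast_atTop_atTop.eventually_ge_atTop (4 / ‖z - 1‖)] with N hN
  have e : ∀ j : ℕ, ‖1 - z ^ j‖ ^ 2 = 2 - 2 * (z ^ j).re := by
    intro j
    have h1 : ‖z ^ j‖ ^ 2 = 1 := by rw [norm_pow, hz]; simp
    rw [← Complex.normSq_eq_norm_sq, Complex.normSq_apply] at h1 ⊢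
    simp only [Complex.sub_re, Complex.one_re, Complex.sub_im, Complex.one_im]
    linarith
  simp_rw [e]
  rw [Finset.sum_sub_distrib, ← Finset.mul_sum, ← Complex.re_sum, geom_sum_eq hz1]
  have h2 : ((z ^ N - 1) / (z - 1)).re ≤ 2 / ‖z - 1‖ := by
    refine (Complex.re_le_norm _).trans ?_
    rw [norm_div]
    gcongr
    refine (norm_sub_le _ _).trans_eq ?_
    rw [norm_pow, hz]
    norm_num
  have h3 : 4 / ‖z - 1‖ = 2 * (2 / ‖z - 1‖) := by ring
  simp only [Finset.sum_const, Finset.card_range, nsmul_eq_mul]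
  linarith

theorem setLIntegral_thermal_le {f : ℝ → ℂ} (hf : Integrable f)
    (hfp : ∀ᵐ p : ℝ, p ≤ 0 → ft f p = 0) :
    ∫⁻ p in Ioc 0 1, ENNReal.ofReal (‖ft f p‖ ^ 2 / (2 * p * (Real.exp (2 * Real.pi * p) - 1))) ≤
      4 * No xR f := by
  have hcf := continuous_ft hf
  set w : ℝ → ℝ≥0∞ := fun p =>
    ENNReal.ofReal (‖ft f p‖ ^ 2 / (2 * p * (Real.exp (2 * Real.pi * p) - 1))) with hw
  have hwm : Measurable w := by
    have := hcf.measurable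
    fun_prop
  set a : ℕ → ℝ → ℝ≥0∞ := fun j p =>
    ENNReal.ofReal (‖1 - Complex.exp (-Complex.I * p * (j : ℝ))‖ ^ 2) with ha
  have ham : ∀ j, Measurable (a j) := fun j => by fun_prop
  have hwam : ∀ j, Measurable fun p => w p * a j p := fun j => hwm.mul (ham j)
  set F : ℕ → ℝ → ℝ≥0∞ := fun N p => (N : ℝ≥0∞)⁻¹ * ∑ j ∈ Finset.range N, w p * a j p with hF
  have hFm : ∀ N, Measurable (F N) := fun N => by
    refine Measurable.const_mul ?_ _
    exact Finset.measurable_fun_sum _ fun j _ => hwam j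
  have hFle : ∀ N, ∫⁻ p in Ioc 0 1, F N p ≤ 4 * No xR f := by
    intro N
    rw [lintegral_const_mul _ (Finset.measurable_fun_sum _ fun j _ => hwam j),
      lintegral_finsetSum _ fun j _ => hwam j]
    calc _ ≤ (N : ℝ≥0∞)⁻¹ * ∑ j ∈ Finset.range N, 4 * No xR f := by
          gcongr with j
          exact setLIntegral_thermal_mul_le hf hfp j
      _ = (N : ℝ≥0∞)⁻¹ * N * (4 * No xR f) := by simp [mul_assoc]
      _ ≤ 1 * (4 * No xR f) := by
          gcongr
          exact ENNReal.inv_mul_le_one _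
      _ = _ := one_mul _
  calc ∫⁻ p in Ioc 0 1, w p ≤ ∫⁻ p in Ioc 0 1, liminf (fun N => F N p) atTop := by
        refine setLIntegral_mono' measurableSet_Ioc fun p hp => ?_
        have hz1 : Complex.exp (-Complex.I * p) ≠ 1 := by
          intro h
          have h1 := congrArg Complex.im h
          have h2 : Real.sin p = 0 := by
            rw [Complex.exp_im] at h1
            simpa using h1
          exact (Real.sin_pos_of_pos_of_lt_pi hp.1
            (hp.2.trans_lt (by linarith [Real.pi_gt_three]))).ne' h2
        have hz : ‖Complex.exp (-Complex.I * p)‖ = 1 := by simp [Complex.norm_exp]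
        refine le_liminf_of_le (by isBoundedDefault) ?_
        filter_upwards [eventually_le_sum_norm_one_sub_pow_sq hz hz1, eventually_gt_atTop 0]
          with N hN hN0
        have hs : (N : ℝ≥0∞) ≤ ∑ j ∈ Finset.range N, a j p := by
          rw [← ENNReal.ofReal_natCast, ha, ← ENNReal.ofReal_sum_of_nonneg
            (fun _ _ => by positivity)]
          refine ENNReal.ofReal_le_ofReal (hN.trans_eq ?_)
          refine Finset.sum_congr rfl fun j _ => ?_
          rw [← Complex.exp_nat_mul]
          congr 4
          push_cast
          ring
        simp only [hF]
        rw [← Finset.mul_sum]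
        calc w p = w p * ((N : ℝ≥0∞)⁻¹ * N) := by
              rw [ENNReal.inv_mul_cancel (by exact_mod_cast hN0.ne') (by simp), mul_one]
          _ ≤ w p * ((N : ℝ≥0∞)⁻¹ * ∑ j ∈ Finset.range N, a j p) := by gcongr
          _ = _ := by ring
    _ ≤ liminf (fun N => ∫⁻ p in Ioc 0 1, F N p) atTop := lintegral_liminf_le hFm
    _ ≤ liminf (fun _ : ℕ => 4 * No xR f) atTop :=
        liminf_le_liminf (Eventually.of_forall hFle)
    _ = _ := tendsto_const_nhds.liminf_eq

/-- For the relativistic map `x_R`, an integrable `f` with `f̂(p) = 0` for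
a.e. `p ≤ 0` satisfies `N̄_o[f] = ∫_0^∞ |f̂(p)|²/(2p(e^{2πp}-1)) dp` in `[0,∞]`:
the spontaneous emission is exactly thermal at inverse temperature `2π`. -/
theorem stmt_1 (f : ℝ → ℂ) (hf : MeasureTheory.Integrable f)
    (hfp : ∀ᵐ p : ℝ, p ≤ 0 → ft f p = 0) :
    No xR f = Nth (2 * Real.pi) f := by
  by_cases hD : ∫⁻ p in Ioc 0 1,
      ENNReal.ofReal (‖ft f p‖ ^ 2 / (2 * p * (Real.exp (2 * Real.pi * p) - 1))) = ⊤
  · have h1 : Nth (2 * Real.pi) f = ⊤ :=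
      top_le_iff.1 (hD ▸ lintegral_mono_set Ioc_subset_Ioi_self)
    have h2 := setLIntegral_thermal_le hf hfp
    rw [hD, top_le_iff, ENNReal.mul_eq_top] at h2
    rw [h1]
    simpa using h2
  · exact No_xR_eq_Nth_of_ne_top hf hfp (lintegral_enorm_ft_sq_div_sq_ne_top_of_thermal hD)
end
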